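/- arXiv:q-alg/9601024 — 2 statements merged into one kernel-verified Lean document; each statement's English description precedes it below -/
import Mathlib

section
/- Let (A,β) be a braided Hopf algebra over a field k. Then the double A ⋈ A = A ⋈_β A carries a braiding γ given by γ(a ⊗ b, a' ⊗ b') = Σ β(a, a₁'b₁') β⁻¹(a₂'b₂', b): this form is convolution-invertible, it is a skew pairing on (A ⋈ A, A ⋈ A) with respect to the double multiplication, and it satisfies Σ y₁x₁ γ(x₂,y₂) = Σ γ(x₁,y₁) x₂y₂ for all x,y ∈ A ⋈ A (products taken in A ⋈ A). -/
/-!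
STATEMENT 7: Let (A,β) be a braided Hopf algebra over a field k.  Then the double
A ⋈ A = A ⋈_β A carries a braiding γ given by
γ(a⊗b, a'⊗b') = Σ β(a, a₁'b₁') β⁻¹(a₂'b₂', b):
this form is convolution-invertible, a skew pairing on (A ⋈ A, A ⋈ A) with respect to the
double multiplication, and Σ y₁x₁ γ(x₂,y₂) = Σ γ(x₁,y₁) x₂y₂ in A ⋈ A.
-/

open TensorProduct Coalgebra LinearMap

noncomputable section

variable {k : Type} [Field k]

/-- Convolution product of linear maps from a coalgebra `C` to an algebra `M`:
`(f * g)(c) = Σ f(c₁) g(c₂)`. -/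
def conv {C M : Type} [AddCommGroup C] [Module k C] [Coalgebra k C]
    [Ring M] [Algebra k M] (f g : C →ₗ[k] M) : C →ₗ[k] M :=
  (LinearMap.mul' k M) ∘ₗ (TensorProduct.map f g) ∘ₗ Coalgebra.comul

/-- `Σ g(c₁) • f(c₂)`. -/
def convL {C M : Type} [AddCommGroup C] [Module k C] [Coalgebra k C]
    [AddCommGroup M] [Module k M] (g : C →ₗ[k] k) (f : C →ₗ[k] M) : C →ₗ[k] M :=
  (TensorProduct.lid k M).toLinearMap ∘ₗ (TensorProduct.map g f) ∘ₗ Coalgebra.comul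

/-- `Σ g(c₂) • f(c₁)`. -/
def convR {C M : Type} [AddCommGroup C] [Module k C] [Coalgebra k C]
    [AddCommGroup M] [Module k M] (f : C →ₗ[k] M) (g : C →ₗ[k] k) : C →ₗ[k] M :=
  (TensorProduct.rid k M).toLinearMap ∘ₗ (TensorProduct.map f g) ∘ₗ Coalgebra.comul

/-- Convolution invertibility of a bilinear form. -/
def IsConvInvertible {C : Type} [AddCommGroup C] [Module k C] [Coalgebra k C]
    (τ : C →ₗ[k] k) : Prop :=
  ∃ τi : C →ₗ[k] k, conv τ τi = Coalgebra.counit ∧ conv τi τ = Coalgebra.counit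

/-- A skew pairing on the ordered pair `(A, U)`. -/
structure IsSkewPairing {A U : Type} [Ring A] [Ring U] [HopfAlgebra k A] [HopfAlgebra k U]
    (τ : A ⊗[k] U →ₗ[k] k) : Prop where
  mul_left : ∀ (b c : A) (u : U),
    τ ((b * c) ⊗ₜ u) = conv (τ ∘ₗ TensorProduct.mk k A U b) (τ ∘ₗ TensorProduct.mk k A U c) u
  mul_right : ∀ (b : A) (u v : U),
    τ (b ⊗ₜ (u * v)) =
      conv (τ ∘ₗ (TensorProduct.mk k A U).flip v) (τ ∘ₗ (TensorProduct.mk k A U).flip u) b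
  one_left : ∀ u : U, τ (1 ⊗ₜ u) = Coalgebra.counit u
  one_right : ∀ a : A, τ (a ⊗ₜ 1) = Coalgebra.counit a

/-- A braiding on a Hopf algebra `A`. -/
structure IsBraiding {A : Type} [Ring A] [HopfAlgebra k A] (β : A ⊗[k] A →ₗ[k] k) : Prop where
  skew : IsSkewPairing β
  invertible : IsConvInvertible β
  compat : ∀ a b : A,
    convR ((LinearMap.mul' k A) ∘ₗ (TensorProduct.comm k A A).toLinearMap) β (a ⊗ₜ b)
      = convL β (LinearMap.mul' k A) (a ⊗ₜ b)

variable {A : Type} [Ring A] [HopfAlgebra k A]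

/-- The linear map `A ⊗ A → A ⊗ A`, `b ⊗ u ↦ Σ β(b₁,u₁) (b₂ ⊗ u₂) β⁻¹(b₃,u₃)`. -/
def doubleInner (β βi : A ⊗[k] A →ₗ[k] k) : A ⊗[k] A →ₗ[k] A ⊗[k] A :=
  conv (conv ((Algebra.linearMap k (A ⊗[k] A)) ∘ₗ β) LinearMap.id)
    ((Algebra.linearMap k (A ⊗[k] A)) ∘ₗ βi)

/-- The braiding `γ(a⊗b, a'⊗b') = Σ β(a, a₁'b₁') β⁻¹(a₂'b₂', b)` on the double `A ⋈ A`. -/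
def gammaForm (β βi : A ⊗[k] A →ₗ[k] k) :
    (A ⊗[k] A) ⊗[k] (A ⊗[k] A) →ₗ[k] k :=
  (LinearMap.mul' k k) ∘ₗ
    TensorProduct.map β (βi ∘ₗ (TensorProduct.comm k A A).toLinearMap) ∘ₗ
    (TensorProduct.tensorTensorTensorComm k A A A A).toLinearMap ∘ₗ
    LinearMap.lTensor (A ⊗[k] A)
      (TensorProduct.map (LinearMap.mul' k A) (LinearMap.mul' k A) ∘ₗ Coalgebra.comul)

section Coassoc

variable {C X X' Y Y' Z : Type} [AddCommGroup C] [Module k C] [Coalgebra k C]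
  [AddCommGroup X] [Module k X] [AddCommGroup X'] [Module k X'] [AddCommGroup Y] [Module k Y]
  [AddCommGroup Y'] [Module k Y'] [AddCommGroup Z] [Module k Z]

theorem map_map_comp_middle (f : C →ₗ[k] X) (g : C →ₗ[k] X') (h : C →ₗ[k] Y) (l : C →ₗ[k] Y') :
    TensorProduct.map (TensorProduct.map f g ∘ₗ comul) (TensorProduct.map h l ∘ₗ comul) ∘ₗ comul =
      (TensorProduct.assoc k (X ⊗[k] X') Y Y').toLinearMap ∘ₗ
        rTensor Y' (TensorProduct.assoc k X X' Y).symm.toLinearMap ∘ₗ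
        (TensorProduct.assoc k X (X' ⊗[k] Y) Y').symm.toLinearMap ∘ₗ
        TensorProduct.map f (TensorProduct.map (TensorProduct.map g h ∘ₗ comul) l ∘ₗ comul) ∘ₗ
        comul := by
  simp only [coassoc_simps]

theorem map_map_comul_comp_comul (f : C →ₗ[k] X) (g : C →ₗ[k] Y) (h : C →ₗ[k] Z) :
    TensorProduct.map (TensorProduct.map f g ∘ₗ comul) h ∘ₗ comul =
      (TensorProduct.assoc k X Y Z).symm.toLinearMap ∘ₗ
        TensorProduct.map f (TensorProduct.map g h ∘ₗ comul) ∘ₗ comul := by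
  simp only [coassoc_simps]

theorem map_comul_map_comp_comul (f : C →ₗ[k] X) (g : C →ₗ[k] Y) (h : C →ₗ[k] Z) :
    TensorProduct.map f (TensorProduct.map g h ∘ₗ comul) ∘ₗ comul =
      (TensorProduct.assoc k X Y Z).toLinearMap ∘ₗ
        TensorProduct.map (TensorProduct.map f g ∘ₗ comul) h ∘ₗ comul := by
  simp only [coassoc_simps]

end Coassoc

section Convolution

open WithConv

variable {C D X Y Z W M R S : Type}
  [AddCommGroup C] [Module k C] [Coalgebra k C] [AddCommGroup D] [Module k D] [Coalgebra k D]
  [AddCommGroup X] [Module k X] [Coalgebra k X] [AddCommGroup Y] [Module k Y] [Coalgebra k Y]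
  [AddCommGroup Z] [Module k Z] [Coalgebra k Z] [AddCommGroup W] [Module k W] [Coalgebra k W]
  [AddCommGroup M] [Module k M]
  [Ring R] [Algebra k R] [Ring S] [Algebra k S]

/-- Precomposition with a coalgebra map, as a homomorphism of convolution monoids. -/
def pullback (f : C →ₗc[k] D) : WithConv (D →ₗ[k] R) →* WithConv (C →ₗ[k] R) where
  toFun g := toConv (g.ofConv ∘ₗ f.toLinearMap)
  map_one' := by ext c; simp [LinearMap.convOne_def]
  map_mul' g h := WithConv.ext (convMul_comp_coalgHom_distrib g h f)

/-- Postcomposition with an algebra map, as a homomorphism of convolution monoids. -/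
def pushforward (φ : R →ₐ[k] S) : WithConv (C →ₗ[k] R) →* WithConv (C →ₗ[k] S) where
  toFun g := toConv (φ.toLinearMap ∘ₗ g.ofConv)
  map_one' := by ext c; simp [LinearMap.convOne_def]
  map_mul' g h := WithConv.ext (algHom_comp_convMul_distrib φ g h)

/-- Two coalgebra maps cocommute if `Σ p(c₁) ⊗ q(c₂) = Σ p(c₂) ⊗ q(c₁)`. -/
def Cocommute (p : C →ₗc[k] X) (q : C →ₗc[k] Y) : Prop :=
  TensorProduct.map p.toLinearMap q.toLinearMap ∘ₗ comul =
    (TensorProduct.comm k Y X).toLinearMap ∘ₗ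
      TensorProduct.map q.toLinearMap p.toLinearMap ∘ₗ comul

theorem Cocommute.symm {p : C →ₗc[k] X} {q : C →ₗc[k] Y} (h : Cocommute p q) :
    Cocommute q p := by
  unfold Cocommute at *
  rw [h, ← LinearMap.comp_assoc]
  ext; simp

/-- The coalgebra map `c ↦ Σ p(c₁) ⊗ q(c₂)` defined by two cocommuting coalgebra maps. -/
def pair (p : C →ₗc[k] X) (q : C →ₗc[k] Y) (h : Cocommute p q) : C →ₗc[k] X ⊗[k] Y where
  toLinearMap := TensorProduct.map p.toLinearMap q.toLinearMap ∘ₗ comul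
  counit_comp := by
    have e : (counit : X ⊗[k] Y →ₗ[k] k) ∘ₗ TensorProduct.map p.toLinearMap q.toLinearMap =
        (TensorProduct.lid k k).toLinearMap ∘ₗ lTensor k counit ∘ₗ rTensor C counit := by
      ext; simp [mul_comm]
    rw [← LinearMap.comp_assoc, e, LinearMap.comp_assoc, LinearMap.comp_assoc,
      rTensor_counit_comp_comul]
    ext; simp
  map_comp_comul := by
    have e : comul ∘ₗ TensorProduct.map p.toLinearMap q.toLinearMap ∘ₗ comul =
        (TensorProduct.tensorTensorTensorComm k X X Y Y).toLinearMap ∘ₗ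
          TensorProduct.map (TensorProduct.map p.toLinearMap p.toLinearMap ∘ₗ comul)
            (TensorProduct.map q.toLinearMap q.toLinearMap ∘ₗ comul) ∘ₗ comul := by
      rw [p.map_comp_comul, q.map_comp_comul, TensorProduct.map_comp, comul_def]
      rfl
    rw [e, map_map_comp_middle, map_map_comp_middle, h]
    have e₁ : TensorProduct.map p.toLinearMap (TensorProduct.map
          ((TensorProduct.comm k Y X).toLinearMap ∘ₗ
            TensorProduct.map q.toLinearMap p.toLinearMap ∘ₗ comul) q.toLinearMap ∘ₗ comul) =
        lTensor X (rTensor Y (TensorProduct.comm k Y X).toLinearMap) ∘ₗ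
          TensorProduct.map p.toLinearMap (TensorProduct.map
            (TensorProduct.map q.toLinearMap p.toLinearMap ∘ₗ comul) q.toLinearMap ∘ₗ comul) := by
      rw [lTensor_comp_map, ← LinearMap.comp_assoc comul _ (rTensor Y _), rTensor_comp_map]
    rw [e₁]
    simp only [← LinearMap.comp_assoc]
    congr 2
    ext
    rfl

variable (k X Y) in
/-- The coalgebra map `x ⊗ y ↦ ε(y) x`. -/
def tensorFst : X ⊗[k] Y →ₗc[k] X :=
  (Coalgebra.TensorProduct.rid k k X : X ⊗[k] k →ₗc[k] X).comp
    (Coalgebra.TensorProduct.map (CoalgHom.id k X) (counitCoalgHom k Y))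

variable (k X Y) in
/-- The coalgebra map `x ⊗ y ↦ ε(x) y`. -/
def tensorSnd : X ⊗[k] Y →ₗc[k] Y :=
  (Coalgebra.TensorProduct.lid k Y : k ⊗[k] Y →ₗc[k] Y).comp
    (Coalgebra.TensorProduct.map (counitCoalgHom k X) (CoalgHom.id k Y))

@[simp] theorem fst_tmul (x : X) (y : Y) : tensorFst k X Y (x ⊗ₜ y) = counit (R := k) y • x := rfl
@[simp] theorem snd_tmul (x : X) (y : Y) : tensorSnd k X Y (x ⊗ₜ y) = counit (R := k) x • y := rfl

theorem map_fst_snd_comul :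
    TensorProduct.map (tensorFst k X Y).toLinearMap (tensorSnd k X Y).toLinearMap ∘ₗ comul =
      LinearMap.id := by
  ext x y
  have e : ∀ (s : X ⊗[k] X) (t : Y ⊗[k] Y),
      TensorProduct.map (tensorFst k X Y).toLinearMap (tensorSnd k X Y).toLinearMap
        (AlgebraTensorModule.tensorTensorTensorComm k k k k X X Y Y (s ⊗ₜ t))
        = TensorProduct.rid k X (lTensor X counit s) ⊗ₜ
          TensorProduct.lid k Y (rTensor Y counit t) := by
    intro s t
    induction s with
    | zero => simp
    | add => simp_all [add_tmul]
    | tmul x₁ x₂ =>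
    induction t with
    | zero => simp
    | add => simp_all [tmul_add]
    | tmul y₁ y₂ => simp [smul_tmul, tmul_smul, smul_smul, mul_comm]
  exact (e _ _).trans (by simp)

theorem map_snd_fst_comul :
    TensorProduct.map (tensorSnd k X Y).toLinearMap (tensorFst k X Y).toLinearMap ∘ₗ comul =
      (TensorProduct.comm k X Y).toLinearMap := by
  ext x y
  have e : ∀ (s : X ⊗[k] X) (t : Y ⊗[k] Y),
      TensorProduct.map (tensorSnd k X Y).toLinearMap (tensorFst k X Y).toLinearMap
        (AlgebraTensorModule.tensorTensorTensorComm k k k k X X Y Y (s ⊗ₜ t))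
        = TensorProduct.rid k Y (lTensor Y counit t) ⊗ₜ
          TensorProduct.lid k X (rTensor X counit s) := by
    intro s t
    induction s with
    | zero => simp
    | add => simp_all [add_tmul, tmul_add]
    | tmul x₁ x₂ =>
    induction t with
    | zero => simp
    | add => simp_all [tmul_add, add_tmul]
    | tmul y₁ y₂ => simp [smul_tmul, tmul_smul, smul_smul, mul_comm]
  exact (e _ _).trans (by simp)

theorem cocommute_fst_snd : Cocommute (tensorFst k X Y) (tensorSnd k X Y) := by
  rw [Cocommute, map_fst_snd_comul, map_snd_fst_comul]
  ext; simp

theorem pair_tensorFst_tensorSnd :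
    pair (tensorFst k X Y) (tensorSnd k X Y) cocommute_fst_snd = CoalgHom.id k _ := by
  ext x
  exact congr($(map_fst_snd_comul (k := k) (X := X) (Y := Y)) x)

theorem Cocommute.comp {p : C →ₗc[k] X} {q : C →ₗc[k] Y} (h : Cocommute p q) (f : D →ₗc[k] C) :
    Cocommute (p.comp f) (q.comp f) := by
  have := congr($h ∘ₗ f.toLinearMap)
  simp only [LinearMap.comp_assoc, ← f.map_comp_comul] at this
  simp only [← LinearMap.comp_assoc, ← TensorProduct.map_comp] at this
  rw [LinearMap.comp_assoc] at this
  exact this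

theorem pair_comp {p : C →ₗc[k] X} {q : C →ₗc[k] Y} (h : Cocommute p q) (f : D →ₗc[k] C) :
    (pair p q h).comp f = pair (p.comp f) (q.comp f) (h.comp f) := by
  apply CoalgHom.coe_linearMap_injective
  change (TensorProduct.map p.toLinearMap q.toLinearMap ∘ₗ comul) ∘ₗ f.toLinearMap =
    TensorProduct.map (p.toLinearMap ∘ₗ f.toLinearMap) (q.toLinearMap ∘ₗ f.toLinearMap) ∘ₗ comul
  rw [LinearMap.comp_assoc, ← f.map_comp_comul, TensorProduct.map_comp, LinearMap.comp_assoc]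

theorem Cocommute.map {p : C →ₗc[k] X} {q : C →ₗc[k] Y} (h : Cocommute p q) (f : X →ₗc[k] Z)
    (g : Y →ₗc[k] W) :
    Cocommute (f.comp p) (g.comp q) := by
  change TensorProduct.map (f.toLinearMap ∘ₗ p.toLinearMap) (g.toLinearMap ∘ₗ q.toLinearMap) ∘ₗ
    comul = (TensorProduct.comm k W Z).toLinearMap ∘ₗ TensorProduct.map
      (g.toLinearMap ∘ₗ q.toLinearMap) (f.toLinearMap ∘ₗ p.toLinearMap) ∘ₗ comul
  rw [TensorProduct.map_comp, TensorProduct.map_comp, LinearMap.comp_assoc, h,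
    ← LinearMap.comp_assoc, TensorProduct.map_comp_comm_eq]
  rfl

theorem Cocommute.commute {p : C →ₗc[k] X} {q : C →ₗc[k] Y} (h : Cocommute p q)
    (f : WithConv (X →ₗ[k] R)) (g : WithConv (Y →ₗ[k] R)) (hfg : ∀ x y, Commute (f x) (g y)) :
    Commute (pullback p f) (pullback q g) := by
  apply WithConv.ext
  change mul' k R ∘ₗ TensorProduct.map (f.ofConv ∘ₗ p.toLinearMap) (g.ofConv ∘ₗ q.toLinearMap) ∘ₗ
    comul = mul' k R ∘ₗ TensorProduct.map (g.ofConv ∘ₗ q.toLinearMap) (f.ofConv ∘ₗ p.toLinearMap) ∘ₗ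
    comul
  have e : mul' k R ∘ₗ TensorProduct.map f.ofConv g.ofConv ∘ₗ (TensorProduct.comm k Y X).toLinearMap
      = mul' k R ∘ₗ TensorProduct.map g.ofConv f.ofConv := by
    ext y x
    exact hfg x y
  rw [TensorProduct.map_comp, LinearMap.comp_assoc, h, TensorProduct.map_comp,
    ← LinearMap.comp_assoc _ _ (mul' k R), LinearMap.comp_assoc _ _ (TensorProduct.map g.ofConv _),
    ← LinearMap.comp_assoc _ _ (mul' k R), ← e]
  rfl

theorem pair_self (P : C →ₗc[k] X ⊗[k] Y) :
    P = pair ((tensorFst k X Y).comp P) ((tensorSnd k X Y).comp P)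
      (cocommute_fst_snd.comp P) := by
  rw [← pair_comp cocommute_fst_snd, pair_tensorFst_tensorSnd, CoalgHom.id_comp]

theorem fst_comp_pair {p : C →ₗc[k] X} {q : C →ₗc[k] Y} (h : Cocommute p q) :
    (tensorFst k X Y).comp (pair p q h) = p := by
  ext c
  have e : (tensorFst k X Y).toLinearMap ∘ₗ TensorProduct.map p.toLinearMap q.toLinearMap =
      p.toLinearMap ∘ₗ (TensorProduct.rid k C).toLinearMap ∘ₗ lTensor C counit := by
    ext; simp
  exact congr($e (comul c)).trans (by simp)

theorem snd_comp_pair {p : C →ₗc[k] X} {q : C →ₗc[k] Y} (h : Cocommute p q) :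
    (tensorSnd k X Y).comp (pair p q h) = q := by
  ext c
  have e : (tensorSnd k X Y).toLinearMap ∘ₗ TensorProduct.map p.toLinearMap q.toLinearMap =
      q.toLinearMap ∘ₗ (TensorProduct.lid k C).toLinearMap ∘ₗ rTensor C counit := by
    ext; simp
  exact congr($e (comul c)).trans (by simp)

theorem Cocommute.pair_left {p : C →ₗc[k] X} {q : C →ₗc[k] Y} {r : C →ₗc[k] Z}
    (hpq : Cocommute p q) (hpr : Cocommute p r) (hqr : Cocommute q r) :
    Cocommute (pair p q hpq) r := by
  have e₁ : TensorProduct.map p.toLinearMap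
        ((TensorProduct.comm k Z Y).toLinearMap ∘ₗ
          TensorProduct.map r.toLinearMap q.toLinearMap ∘ₗ comul) =
      lTensor X (TensorProduct.comm k Z Y).toLinearMap ∘ₗ
        TensorProduct.map p.toLinearMap (TensorProduct.map r.toLinearMap q.toLinearMap ∘ₗ comul) :=
    (lTensor_comp_map ..).symm
  have e₂ : TensorProduct.map ((TensorProduct.comm k Z X).toLinearMap ∘ₗ
          TensorProduct.map r.toLinearMap p.toLinearMap ∘ₗ comul) q.toLinearMap =
      rTensor Y (TensorProduct.comm k Z X).toLinearMap ∘ₗ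
        TensorProduct.map (TensorProduct.map r.toLinearMap p.toLinearMap ∘ₗ comul) q.toLinearMap :=
    (rTensor_comp_map ..).symm
  change TensorProduct.map (TensorProduct.map p.toLinearMap q.toLinearMap ∘ₗ comul)
    r.toLinearMap ∘ₗ comul = (TensorProduct.comm k Z (X ⊗[k] Y)).toLinearMap ∘ₗ
      TensorProduct.map r.toLinearMap
        (TensorProduct.map p.toLinearMap q.toLinearMap ∘ₗ comul) ∘ₗ comul
  rw [map_map_comul_comp_comul, hqr, e₁, LinearMap.comp_assoc, map_comul_map_comp_comul, hpr, e₂,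
    LinearMap.comp_assoc, map_map_comul_comp_comul]
  simp only [← LinearMap.comp_assoc]
  congr 2
  ext
  rfl

theorem map_comp_pair {p : C →ₗc[k] X} {q : C →ₗc[k] Y} (h : Cocommute p q) (f : X →ₗc[k] Z)
    (g : Y →ₗc[k] W) :
    (Coalgebra.TensorProduct.map f g).comp (pair p q h) =
      pair (f.comp p) (g.comp q) (h.map f g) := by
  apply CoalgHom.coe_linearMap_injective
  change TensorProduct.map f.toLinearMap g.toLinearMap ∘ₗ
    TensorProduct.map p.toLinearMap q.toLinearMap ∘ₗ comul = TensorProduct.map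
      (f.toLinearMap ∘ₗ p.toLinearMap) (g.toLinearMap ∘ₗ q.toLinearMap) ∘ₗ comul
  rw [TensorProduct.map_comp]
  rfl

theorem toConv_convL (s : C →ₗ[k] k) (f : C →ₗ[k] R) :
    toConv (convL s f) = pushforward (Algebra.ofId k R) (toConv s) * toConv f := by
  apply WithConv.ext
  change _ ∘ₗ _ ∘ₗ _ = mul' k R ∘ₗ TensorProduct.map (_ ∘ₗ s) f ∘ₗ comul
  simp only [← LinearMap.comp_assoc]
  congr 1
  ext
  simp [Algebra.ofId_apply, Algebra.smul_def]

theorem toConv_convR (s : C →ₗ[k] k) (f : C →ₗ[k] R) :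
    toConv (convR f s) = toConv f * pushforward (Algebra.ofId k R) (toConv s) := by
  apply WithConv.ext
  change _ ∘ₗ _ ∘ₗ _ = mul' k R ∘ₗ TensorProduct.map f (_ ∘ₗ s) ∘ₗ comul
  simp only [← LinearMap.comp_assoc]
  congr 1
  ext
  simp [Algebra.ofId_apply, Algebra.smul_def, Algebra.commutes]

theorem toConv_comp_lTensor_convL (g : X ⊗[k] M →ₗ[k] k) (s : Y →ₗ[k] k) (f : Y →ₗ[k] M) :
    toConv (g ∘ₗ lTensor X (convL s f)) =
      pullback (tensorSnd k X Y) (toConv s) * toConv (g ∘ₗ lTensor X f) := by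
  ext x y
  have e : ∀ (a : X ⊗[k] X) (t : Y ⊗[k] Y),
      g (TensorProduct.lid k X (rTensor X counit a) ⊗ₜ
        TensorProduct.lid k M (TensorProduct.map s f t)) =
      mul' k k (TensorProduct.map (s ∘ₗ (tensorSnd k X Y).toLinearMap) (g ∘ₗ lTensor X f)
        (AlgebraTensorModule.tensorTensorTensorComm k k k k X X Y Y (a ⊗ₜ t))) := by
    intro a t
    induction a with
    | zero => simp
    | add => simp_all [add_tmul]
    | tmul x₁ x₂ =>
    induction t with
    | zero => simp
    | add => simp_all [tmul_add]
    | tmul y₁ y₂ => simp [smul_tmul, tmul_smul, smul_smul, mul_comm]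
  refine Eq.trans ?_ (e (comul x) (comul y))
  simp [convL]

theorem toConv_comp_lTensor_convR (g : X ⊗[k] M →ₗ[k] k) (s : Y →ₗ[k] k) (f : Y →ₗ[k] M) :
    toConv (g ∘ₗ lTensor X (convR f s)) =
      toConv (g ∘ₗ lTensor X f) * pullback (tensorSnd k X Y) (toConv s) := by
  ext x y
  have e : ∀ (a : X ⊗[k] X) (t : Y ⊗[k] Y),
      g (TensorProduct.rid k X (lTensor X counit a) ⊗ₜ
        TensorProduct.rid k M (TensorProduct.map f s t)) =
      mul' k k (TensorProduct.map (g ∘ₗ lTensor X f) (s ∘ₗ (tensorSnd k X Y).toLinearMap)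
        (AlgebraTensorModule.tensorTensorTensorComm k k k k X X Y Y (a ⊗ₜ t))) := by
    intro a t
    induction a with
    | zero => simp
    | add => simp_all [add_tmul]
    | tmul x₁ x₂ =>
    induction t with
    | zero => simp
    | add => simp_all [tmul_add]
    | tmul y₁ y₂ => simp [smul_tmul, tmul_smul, smul_smul, mul_comm]
  refine Eq.trans ?_ (e (comul x) (comul y))
  simp [convR]

theorem toConv_comp_rTensor_convL (g : M ⊗[k] X →ₗ[k] k) (s : Y →ₗ[k] k) (f : Y →ₗ[k] M) :
    toConv (g ∘ₗ rTensor X (convL s f)) =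
      pullback (tensorFst k Y X) (toConv s) * toConv (g ∘ₗ rTensor X f) := by
  ext y x
  have e : ∀ (t : Y ⊗[k] Y) (a : X ⊗[k] X),
      g (TensorProduct.lid k M (TensorProduct.map s f t) ⊗ₜ
        TensorProduct.lid k X (rTensor X counit a)) =
      mul' k k (TensorProduct.map (s ∘ₗ (tensorFst k Y X).toLinearMap) (g ∘ₗ rTensor X f)
        (AlgebraTensorModule.tensorTensorTensorComm k k k k Y Y X X (t ⊗ₜ a))) := by
    intro t a
    induction a with
    | zero => simp
    | add => simp_all [tmul_add]
    | tmul x₁ x₂ =>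
    induction t with
    | zero => simp
    | add => simp_all [add_tmul]
    | tmul y₁ y₂ => simp [smul_tmul, tmul_smul, smul_smul]
  refine Eq.trans ?_ (e (comul y) (comul x))
  simp [convL]

theorem toConv_comp_rTensor_convR (g : M ⊗[k] X →ₗ[k] k) (s : Y →ₗ[k] k) (f : Y →ₗ[k] M) :
    toConv (g ∘ₗ rTensor X (convR f s)) =
      toConv (g ∘ₗ rTensor X f) * pullback (tensorFst k Y X) (toConv s) := by
  ext y x
  have e : ∀ (t : Y ⊗[k] Y) (a : X ⊗[k] X),
      g (TensorProduct.rid k M (TensorProduct.map f s t) ⊗ₜ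
        TensorProduct.rid k X (lTensor X counit a)) =
      mul' k k (TensorProduct.map (g ∘ₗ rTensor X f) (s ∘ₗ (tensorFst k Y X).toLinearMap)
        (AlgebraTensorModule.tensorTensorTensorComm k k k k Y Y X X (t ⊗ₜ a))) := by
    intro t a
    induction a with
    | zero => simp
    | add => simp_all [tmul_add]
    | tmul x₁ x₂ =>
    induction t with
    | zero => simp
    | add => simp_all [add_tmul]
    | tmul y₁ y₂ => simp [smul_tmul, tmul_smul, smul_smul, mul_comm]
  refine Eq.trans ?_ (e (comul y) (comul x))
  simp [convR]

theorem pullback_mul_pullback_tmul_left (g : X ⊗[k] Z →ₗ[k] k) (h : Y ⊗[k] Z →ₗ[k] k)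
    (x : X) (y : Y) (z : Z) :
    (pullback (Coalgebra.TensorProduct.map (tensorFst k X Y) (CoalgHom.id k Z)) (toConv g) *
      pullback (Coalgebra.TensorProduct.map (tensorSnd k X Y) (CoalgHom.id k Z)) (toConv h))
        ((x ⊗ₜ y) ⊗ₜ z) =
      conv (g ∘ₗ TensorProduct.mk k X Z x) (h ∘ₗ TensorProduct.mk k Y Z y) z := by
  have e : ∀ (s : X ⊗[k] X) (t : Y ⊗[k] Y) (r : Z ⊗[k] Z),
      mul' k k (TensorProduct.map
        (g ∘ₗ TensorProduct.map (tensorFst k X Y).toLinearMap LinearMap.id)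
        (h ∘ₗ TensorProduct.map (tensorSnd k X Y).toLinearMap LinearMap.id)
        (AlgebraTensorModule.tensorTensorTensorComm k k k k (X ⊗[k] Y) (X ⊗[k] Y) Z Z
          (AlgebraTensorModule.tensorTensorTensorComm k k k k X X Y Y (s ⊗ₜ t) ⊗ₜ r))) =
      mul' k k (TensorProduct.map
        (g ∘ₗ TensorProduct.mk k X Z (TensorProduct.rid k X (lTensor X counit s)))
        (h ∘ₗ TensorProduct.mk k Y Z (TensorProduct.lid k Y (rTensor Y counit t))) r) := by
    intro s t r
    induction r with
    | zero => simp
    | add => simp_all [tmul_add]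
    | tmul z₁ z₂ =>
    induction s with
    | zero => simp
    | add => simp_all [add_tmul]
    | tmul x₁ x₂ =>
    induction t with
    | zero => simp
    | add => simp_all [tmul_add, add_tmul]
    | tmul y₁ y₂ => simp [← smul_tmul']; ring
  exact (e (comul x) (comul y) (comul z)).trans (by simp [conv])

theorem pullback_mul_pullback_tmul_right (g : X ⊗[k] Z →ₗ[k] k) (h : X ⊗[k] Y →ₗ[k] k)
    (x : X) (y : Y) (z : Z) :
    (pullback (Coalgebra.TensorProduct.map (CoalgHom.id k X) (tensorSnd k Y Z)) (toConv g) *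
      pullback (Coalgebra.TensorProduct.map (CoalgHom.id k X) (tensorFst k Y Z)) (toConv h))
        (x ⊗ₜ (y ⊗ₜ z)) =
      conv (g ∘ₗ (TensorProduct.mk k X Z).flip z) (h ∘ₗ (TensorProduct.mk k X Y).flip y) x := by
  have e : ∀ (r : X ⊗[k] X) (s : Y ⊗[k] Y) (t : Z ⊗[k] Z),
      mul' k k (TensorProduct.map
        (g ∘ₗ TensorProduct.map LinearMap.id (tensorSnd k Y Z).toLinearMap)
        (h ∘ₗ TensorProduct.map LinearMap.id (tensorFst k Y Z).toLinearMap)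
        (AlgebraTensorModule.tensorTensorTensorComm k k k k X X (Y ⊗[k] Z) (Y ⊗[k] Z)
          (r ⊗ₜ AlgebraTensorModule.tensorTensorTensorComm k k k k Y Y Z Z (s ⊗ₜ t)))) =
      mul' k k (TensorProduct.map
        (g ∘ₗ (TensorProduct.mk k X Z).flip (TensorProduct.rid k Z (lTensor Z counit t)))
        (h ∘ₗ (TensorProduct.mk k X Y).flip (TensorProduct.lid k Y (rTensor Y counit s))) r) := by
    intro r s t
    induction r with
    | zero => simp
    | add => simp_all [add_tmul]
    | tmul z₁ z₂ =>
    induction s with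
    | zero => simp
    | add => simp_all [add_tmul, tmul_add]
    | tmul x₁ x₂ =>
    induction t with
    | zero => simp
    | add => simp_all [tmul_add, add_mul]
    | tmul y₁ y₂ => simp; ring
  exact (e (comul x) (comul y) (comul z)).trans (by simp [conv])

theorem pullback_pullback (f : C →ₗc[k] D) (g : D →ₗc[k] X) (h : WithConv (X →ₗ[k] R)) :
    pullback f (pullback g h) = pullback (g.comp f) h := rfl

theorem Cocommute.pair_right {p : C →ₗc[k] X} {q : C →ₗc[k] Y} {r : C →ₗc[k] Z}
    (hqr : Cocommute q r) (hpq : Cocommute p q) (hpr : Cocommute p r)  :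
    Cocommute p (pair q r hqr) :=
  (Cocommute.pair_left hqr hpq.symm hpr.symm).symm

end Convolution

section Braid

open WithConv

variable {C : Type} [AddCommGroup C] [Module k C] [Coalgebra k C]

/-- The convolution product of two cocommuting coalgebra maps. -/
def pairMul (p q : C →ₗc[k] A) (h : Cocommute p q) : C →ₗc[k] A :=
  (Bialgebra.mulCoalgHom k A).comp (pair p q h)

theorem Cocommute.pairMul_left {p q r : C →ₗc[k] A} (hpq : Cocommute p q) (hpr : Cocommute p r)
    (hqr : Cocommute q r) : Cocommute (pairMul p q hpq) r :=
  (hpq.pair_left hpr hqr).map (Bialgebra.mulCoalgHom k A) (CoalgHom.id k A)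

theorem Cocommute.pairMul_right {p q r : C →ₗc[k] A} (hqr : Cocommute q r) (hpq : Cocommute p q)
    (hpr : Cocommute p r) : Cocommute p (pairMul q r hqr) :=
  (hqr.pairMul_left hpq.symm hpr.symm).symm

/-- The pullback of an invertible form on `A ⊗ A` along a pair of cocommuting coalgebra maps. -/
def braid (β : (WithConv (A ⊗[k] A →ₗ[k] k))ˣ) (p q : C →ₗc[k] A) (h : Cocommute p q) :
    (WithConv (C →ₗ[k] k))ˣ :=
  Units.map (pullback (pair p q h)) β

variable {β : (WithConv (A ⊗[k] A →ₗ[k] k))ˣ}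

theorem commute_braid {p q r s : C →ₗc[k] A} (hpq : Cocommute p q) (hrs : Cocommute r s)
    (hpr : Cocommute p r) (hps : Cocommute p s) (hqr : Cocommute q r) (hqs : Cocommute q s) :
    Commute (braid β p q hpq) (braid β r s hrs) :=
  Units.ext <| Cocommute.commute (hrs.pair_right (hpq.pair_left hpr hqr) (hpq.pair_left hps hqs))
    _ _ fun _ _ => mul_comm _ _

theorem braid_pairMul_left (hβ : IsSkewPairing β.val.ofConv) {p q r : C →ₗc[k] A}
    (hpq : Cocommute p q) (hpr : Cocommute p r) (hqr : Cocommute q r) :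
    braid β (pairMul p q hpq) r (hpq.pairMul_left hpr hqr) = braid β p r hpr * braid β q r hqr := by
  have e : pullback (Coalgebra.TensorProduct.map (Bialgebra.mulCoalgHom k A) (CoalgHom.id k A))
      β.val = pullback (Coalgebra.TensorProduct.map (tensorFst k A A) (CoalgHom.id k A)) β.val *
      pullback (Coalgebra.TensorProduct.map (tensorSnd k A A) (CoalgHom.id k A)) β.val := by
    ext x y z
    exact (hβ.mul_left x y z).trans (pullback_mul_pullback_tmul_left _ _ x y z).symm
  have e' := congr(pullback (pair (pair p q hpq) r (hpq.pair_left hpr hqr)) $e)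
  simp only [map_mul, pullback_pullback, map_comp_pair, fst_comp_pair, snd_comp_pair,
    CoalgHom.id_comp] at e'
  exact Units.ext e'

theorem braid_pairMul_right (hβ : IsSkewPairing β.val.ofConv) {p q r : C →ₗc[k] A}
    (hqr : Cocommute q r) (hpq : Cocommute p q) (hpr : Cocommute p r) :
    braid β p (pairMul q r hqr) (hqr.pairMul_right hpq hpr) =
      braid β p r hpr * braid β p q hpq := by
  have e : pullback (Coalgebra.TensorProduct.map (CoalgHom.id k A) (Bialgebra.mulCoalgHom k A))
      β.val = pullback (Coalgebra.TensorProduct.map (CoalgHom.id k A) (tensorSnd k A A)) β.val *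
      pullback (Coalgebra.TensorProduct.map (CoalgHom.id k A) (tensorFst k A A)) β.val := by
    ext x y z
    exact (hβ.mul_right x y z).trans (pullback_mul_pullback_tmul_right _ _ x y z).symm
  have e' := congr(pullback (pair p (pair q r hqr) (hqr.pair_right hpq hpr)) $e)
  simp only [map_mul, pullback_pullback, map_comp_pair, fst_comp_pair, snd_comp_pair,
    CoalgHom.id_comp] at e'
  exact Units.ext e'

theorem braid_compat (hβ : IsBraiding β.val.ofConv) {p q : C →ₗc[k] A} (h : Cocommute p q) :
    toConv q.toLinearMap * toConv p.toLinearMap *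
        pushforward (Algebra.ofId k A) (braid β p q h).val =
      pushforward (Algebra.ofId k A) (braid β p q h).val *
        (toConv p.toLinearMap * toConv q.toLinearMap) := by
  have e : convR (mul' k A ∘ₗ (TensorProduct.comm k A A).toLinearMap) β.val.ofConv =
      convL β.val.ofConv (mul' k A) := by
    ext a b
    exact hβ.compat a b
  have e' := congr(pullback (pair p q h) (toConv $e))
  rw [toConv_convR, toConv_convL, map_mul, map_mul] at e'
  have e₁ : pullback (pair p q h) (toConv (mul' k A ∘ₗ (TensorProduct.comm k A A).toLinearMap)) =
      toConv q.toLinearMap * toConv p.toLinearMap :=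
    WithConv.ext congr(mul' k A ∘ₗ $(h.symm)).symm
  rw [e₁] at e'
  exact e'

theorem braid_braid_braid (hβ : IsBraiding β.val.ofConv) {p q r : C →ₗc[k] A}
    (hpq : Cocommute p q) (hpr : Cocommute p r) (hqr : Cocommute q r) :
    braid β p q hpq * braid β p r hpr * braid β q r hqr =
      braid β q r hqr * braid β p r hpr * braid β p q hpq := by
  have e : convR (mul' k A ∘ₗ (TensorProduct.comm k A A).toLinearMap) β.val.ofConv =
      convL β.val.ofConv (mul' k A) := by
    ext a b
    exact hβ.compat a b
  have e' := congr(pullback (pair p (pair q r hqr) (hqr.pair_right hpq hpr))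
    (toConv (β.val.ofConv ∘ₗ lTensor A $e)))
  rw [toConv_comp_lTensor_convR, toConv_comp_lTensor_convL, map_mul, map_mul, pullback_pullback,
    snd_comp_pair] at e'
  have e₁ : pullback (pair p (pair q r hqr) (hqr.pair_right hpq hpr))
      (toConv (β.val.ofConv ∘ₗ lTensor A (mul' k A))) =
      (braid β p (pairMul q r hqr) (hqr.pairMul_right hpq hpr)).val := by
    have := map_comp_pair (hqr.pair_right hpq hpr) (CoalgHom.id k A) (Bialgebra.mulCoalgHom k A)
    simp only [CoalgHom.id_comp] at this
    exact congr(pullback $this β.val)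
  have e₂ : pullback (pair p (pair q r hqr) (hqr.pair_right hpq hpr))
      (toConv (β.val.ofConv ∘ₗ lTensor A (mul' k A ∘ₗ (TensorProduct.comm k A A).toLinearMap))) =
      (braid β p (pairMul r q hqr.symm) (hqr.symm.pairMul_right hpr hpq)).val := by
    have := map_comp_pair (hqr.symm.pair_right hpr hpq) (CoalgHom.id k A)
      (Bialgebra.mulCoalgHom k A)
    simp only [CoalgHom.id_comp] at this
    refine Eq.trans ?_ congr(pullback $this β.val)
    apply WithConv.ext
    change β.val.ofConv ∘ₗ lTensor A (mul' k A ∘ₗ (TensorProduct.comm k A A).toLinearMap) ∘ₗ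
      TensorProduct.map p.toLinearMap
        (TensorProduct.map q.toLinearMap r.toLinearMap ∘ₗ comul) ∘ₗ comul =
      β.val.ofConv ∘ₗ lTensor A (mul' k A) ∘ₗ TensorProduct.map p.toLinearMap
        (TensorProduct.map r.toLinearMap q.toLinearMap ∘ₗ comul) ∘ₗ comul
    rw [hqr.symm, ← LinearMap.comp_assoc comul _ (lTensor A (mul' k A)), lTensor_comp_map,
      ← LinearMap.comp_assoc comul _ (lTensor A (mul' k A ∘ₗ _)), lTensor_comp_map]
    rfl
  rw [e₁, e₂, braid_pairMul_right hβ.skew hqr.symm hpr hpq,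
    braid_pairMul_right hβ.skew hqr hpq hpr] at e'
  refine Units.ext (e'.trans ?_)
  exact (mul_assoc _ _ _).symm

/-- The form `β(a, cd) β⁻¹(cd, b)` in terms of the coordinates `a`, `b`, `c`, `d`. -/
theorem pullback_gammaForm (hβ : IsSkewPairing β.val.ofConv) {a b c d : C →ₗc[k] A}
    (hab : Cocommute a b) (hcd : Cocommute c d) (hac : Cocommute a c) (had : Cocommute a d)
    (hcb : Cocommute c b) (hdb : Cocommute d b) (h : Cocommute (pair a b hab) (pair c d hcd)) :
    pullback (pair (pair a b hab) (pair c d hcd) h)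
      (toConv (gammaForm β.val.ofConv β⁻¹.val.ofConv)) =
    (braid β a d had * braid β a c hac * (braid β d b hdb)⁻¹ * (braid β c b hcb)⁻¹).val := by
  have e : toConv (gammaForm β.val.ofConv β⁻¹.val.ofConv) =
      pullback (Coalgebra.TensorProduct.map (tensorFst k A A) (Bialgebra.mulCoalgHom k A)) β.val *
      pullback (Coalgebra.TensorProduct.map (tensorSnd k A A) (Bialgebra.mulCoalgHom k A))
        (toConv (β⁻¹.val.ofConv ∘ₗ (TensorProduct.comm k A A).toLinearMap)) := by
    ext a b c d
    have e : ∀ (s t u v : A ⊗[k] A),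
        mul' k k (TensorProduct.map β.val.ofConv
          (β⁻¹.val.ofConv ∘ₗ (TensorProduct.comm k A A).toLinearMap)
          (TensorProduct.tensorTensorTensorComm k A A A A
            ((TensorProduct.rid k A (lTensor A counit s) ⊗ₜ
                TensorProduct.lid k A (rTensor A counit t)) ⊗ₜ
              TensorProduct.map (mul' k A) (mul' k A)
                (AlgebraTensorModule.tensorTensorTensorComm k k k k A A A A (u ⊗ₜ v))))) =
        mul' k k (TensorProduct.map
          (β.val.ofConv ∘ₗ TensorProduct.map (tensorFst k A A).toLinearMap (mul' k A))
          (β⁻¹.val.ofConv ∘ₗ (TensorProduct.comm k A A).toLinearMap ∘ₗ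
            TensorProduct.map (tensorSnd k A A).toLinearMap (mul' k A))
          (AlgebraTensorModule.tensorTensorTensorComm k k k k (A ⊗[k] A) (A ⊗[k] A) (A ⊗[k] A)
            (A ⊗[k] A) (AlgebraTensorModule.tensorTensorTensorComm k k k k A A A A (s ⊗ₜ t) ⊗ₜ
              AlgebraTensorModule.tensorTensorTensorComm k k k k A A A A (u ⊗ₜ v)))) := by
      intro s t u v
      induction s with
      | zero => simp
      | add => simp_all [add_tmul]
      | tmul a₁ a₂ =>
      induction t with
      | zero => simp
      | add => simp_all [add_tmul, tmul_add]
      | tmul b₁ b₂ =>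
      induction u with
      | zero => simp
      | add => simp_all [add_tmul, tmul_add]
      | tmul c₁ c₂ =>
      induction v with
      | zero => simp
      | add => simp_all [tmul_add]
      | tmul d₁ d₂ => simp [← smul_tmul', tmul_smul]; ring
    refine Eq.trans ?_ (e (comul a) (comul b) (comul c) (comul d))
    simp [gammaForm]
  have e' := congr(pullback (pair (pair a b hab) (pair c d hcd) h) $e)
  rw [map_mul, pullback_pullback, pullback_pullback, map_comp_pair, map_comp_pair] at e'
  simp only [fst_comp_pair, snd_comp_pair] at e'
  rw [e', mul_assoc _ _⁻¹, ← mul_inv_rev, ← braid_pairMul_left hβ hcd hcb hdb,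
    ← braid_pairMul_right hβ hcd hac had]
  rw [Units.val_mul]
  congr 1
  apply WithConv.ext
  change β⁻¹.val.ofConv ∘ₗ (TensorProduct.comm k A A).toLinearMap ∘ₗ _ = β⁻¹.val.ofConv ∘ₗ _
  congr 1
  exact Eq.symm (hcd.pairMul_left hcb hdb)

end Braid

section Double

open WithConv

section Abstract

variable {G : Type*} [Group G]

theorem Commute.conj_mul_eq_of_braid_left {ac ad bc bd bu cu cv du dv : G}
    (h₁ : bd * bu * du = du * bu * bd) (h₂ : bc * bu * cu = cu * bu * bc)
    (h₃ : Commute bu ad) (h₄ : Commute bu ac) (h₅ : Commute bd ac) (h₆ : Commute cu dv)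
    (h₇ : Commute bu dv) (h₈ : Commute bu cv) (h₉ : Commute cu bd) (h₁₀ : Commute du bc) :
    bu * ((ad * bd) * (ac * bc) * (dv * du)⁻¹ * (cv * cu)⁻¹) * bu⁻¹ =
      (ad * ac * du⁻¹ * cu⁻¹) * (bd * bc * dv⁻¹ * cv⁻¹) := by
  have key : bu * (bd * bc) * (bu * cu * du)⁻¹ = (cu * du)⁻¹ * (bd * bc) := by
    rw [mul_inv_eq_iff_eq_mul, mul_assoc, eq_inv_mul_iff_mul_eq]
    calc cu * du * (bu * (bd * bc)) = cu * (du * bu * bd) * bc := by group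
      _ = cu * bd * bu * (du * bc) := by rw [← h₁]; group
      _ = bd * (cu * bu * bc) * du := by rw [h₉.eq, h₁₀.eq]; group
      _ = _ := by rw [← h₂]; group
  calc _ = bu * ad * (bd * ac) * bc * du⁻¹ * (dv⁻¹ * cu⁻¹) * (cv⁻¹ * bu⁻¹) := by group
    _ = ad * (bu * ac) * bd * bc * du⁻¹ * cu⁻¹ * (dv⁻¹ * bu⁻¹) * cv⁻¹ := by
      rw [h₃.eq, h₅.eq, h₆.inv_inv.symm.eq, h₈.inv_inv.symm.eq]; group
    _ = ad * ac * (bu * (bd * bc) * (bu * cu * du)⁻¹) * dv⁻¹ * cv⁻¹ := by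
      rw [h₄.eq, h₇.inv_inv.symm.eq]; group
    _ = _ := by rw [key]; group

theorem Commute.conj_mul_eq_of_braid_right {ac ad ae af cb db eb fb ed : G}
    (h₁ : ae * ad * ed = ed * ad * ae) (h₂ : ed * eb * db = db * eb * ed)
    (h₃ : Commute ed af) (h₄ : Commute ed cb) (h₅ : Commute ed ac) (h₆ : Commute ed fb)
    (h₇ : Commute fb ad) (h₈ : Commute fb ac) (h₉ : Commute eb ad) (h₁₀ : Commute eb ac) :
    ed * ((af * ad) * (ae * ac) * (db * fb)⁻¹ * (cb * eb)⁻¹) * ed⁻¹ =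
      (af * ae * fb⁻¹ * eb⁻¹) * (ad * ac * db⁻¹ * cb⁻¹) := by
  have c : Commute (ad * ac) (fb⁻¹ * eb⁻¹) :=
    ((h₇.symm.mul_left h₈.symm).inv_right).mul_right ((h₉.symm.mul_left h₁₀.symm).inv_right)
  calc _ = ed * af * (ad * ae * ac * fb⁻¹ * db⁻¹ * eb⁻¹) * (cb⁻¹ * ed⁻¹) := by group
    _ = af * (ed * ad * ae) * (ac * fb⁻¹) * (ed * eb * db)⁻¹ * cb⁻¹ := by
      rw [h₃.eq, h₄.inv_inv.symm.eq]; group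
    _ = af * ae * ad * (ed * (ac * fb⁻¹)) * (ed⁻¹ * eb⁻¹ * db⁻¹) * cb⁻¹ := by
      rw [← h₁, h₂]; group
    _ = af * ae * ((ad * ac) * (fb⁻¹ * eb⁻¹)) * db⁻¹ * cb⁻¹ := by
      rw [(h₅.mul_right h₆.inv_right).eq]; group
    _ = _ := by rw [c.eq]; group

theorem Commute.conj_mul_eq_of_compat {M : Type*} [Monoid M] {ac ad cb db : Mˣ} {a b c d : M}
    (h₁ : c * a * ac = ac * (a * c)) (h₂ : b * d * db = db * (d * b))
    (h₃ : Commute (ac : M) (d * b)) (h₄ : Commute (db : M) (a * c)) :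
    (ad * (c * a * (d * b)) * (ad⁻¹ : Mˣ)) * (ad * ac * db⁻¹ * cb⁻¹ : Mˣ) =
      (ad * ac * db⁻¹ * cb⁻¹ : Mˣ) * (cb * (a * c * (b * d)) * (cb⁻¹ : Mˣ)) := by
  have h₂' : d * b * (db⁻¹ : Mˣ) = (db⁻¹ : Mˣ) * (b * d) := by
    rw [Units.mul_inv_eq_iff_eq_mul, mul_assoc, h₂, Units.inv_mul_cancel_left]
  have h₄' : (db⁻¹ : Mˣ) * (a * c) = (a * c) * (db⁻¹ : Mˣ) :=
    h₄.symm.units_inv_right.symm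
  simp only [Units.val_mul]
  calc _ = ad * (c * a) * ((d * b) * ac) * ((db⁻¹ : Mˣ) * (cb⁻¹ : Mˣ)) := by
        simp only [mul_assoc, Units.inv_mul_cancel_left]
    _ = ad * (c * a * ac) * (d * b * (db⁻¹ : Mˣ)) * (cb⁻¹ : Mˣ) := by
        rw [← h₃.eq]; simp only [mul_assoc]
    _ = ad * ac * (a * c * (db⁻¹ : Mˣ)) * (b * d) * (cb⁻¹ : Mˣ) := by
        rw [h₁, h₂']; simp only [mul_assoc]
    _ = _ := by
        rw [← h₄']; simp only [mul_assoc, Units.inv_mul_cancel_left]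

end Abstract

variable {C D X Y Z : Type} [AddCommGroup C] [Module k C] [Coalgebra k C]
  [AddCommGroup D] [Module k D] [Coalgebra k D]
  [AddCommGroup X] [Module k X] [Coalgebra k X] [AddCommGroup Y] [Module k Y] [Coalgebra k Y]

theorem map_eq_pair (f : X →ₗc[k] C) (g : Y →ₗc[k] D) :
    Coalgebra.TensorProduct.map f g =
      pair (f.comp (tensorFst k X Y)) (g.comp (tensorSnd k X Y)) (cocommute_fst_snd.map f g) := by
  rw [← map_comp_pair cocommute_fst_snd, pair_tensorFst_tensorSnd, CoalgHom.comp_id]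

theorem tensorFst_comp_pairMul {x y : C →ₗc[k] A ⊗[k] A} (h : Cocommute x y) :
    (tensorFst k A A).comp (pairMul x y h) =
      pairMul ((tensorFst k A A).comp x) ((tensorFst k A A).comp y) (h.map _ _) := by
  have e : (tensorFst k A A).comp (Bialgebra.mulCoalgHom k (A ⊗[k] A)) =
      (Bialgebra.mulCoalgHom k A).comp
        (Coalgebra.TensorProduct.map (tensorFst k A A) (tensorFst k A A)) := by
    apply CoalgHom.coe_linearMap_injective
    ext a b c d
    simp [smul_tmul, tmul_smul, smul_smul, mul_comm]
  rw [pairMul, ← CoalgHom.comp_assoc, e, CoalgHom.comp_assoc, map_comp_pair]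
  rfl

theorem tensorSnd_comp_pairMul {x y : C →ₗc[k] A ⊗[k] A} (h : Cocommute x y) :
    (tensorSnd k A A).comp (pairMul x y h) =
      pairMul ((tensorSnd k A A).comp x) ((tensorSnd k A A).comp y) (h.map _ _) := by
  have e : (tensorSnd k A A).comp (Bialgebra.mulCoalgHom k (A ⊗[k] A)) =
      (Bialgebra.mulCoalgHom k A).comp
        (Coalgebra.TensorProduct.map (tensorSnd k A A) (tensorSnd k A A)) := by
    apply CoalgHom.coe_linearMap_injective
    ext a b c d
    simp [smul_tmul, tmul_smul, smul_smul, mul_comm]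
  rw [pairMul, ← CoalgHom.comp_assoc, e, CoalgHom.comp_assoc, map_comp_pair]
  rfl

/-- The coalgebra map `(a ⊗ u) ⊗ (b ⊗ v) ↦ ε(a) ε(v) b ⊗ u`. -/
def innerCoords (k : Type) [Field k] (A : Type) [Ring A] [HopfAlgebra k A] :
    (A ⊗[k] A) ⊗[k] (A ⊗[k] A) →ₗc[k] A ⊗[k] A :=
  pair ((tensorFst k A A).comp (tensorSnd k _ _)) ((tensorSnd k A A).comp (tensorFst k _ _))
    (cocommute_fst_snd.symm.map _ _)

theorem innerCoords_tmul (a u b v : A) :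
    innerCoords k A ((a ⊗ₜ u) ⊗ₜ (b ⊗ₜ v)) =
      (counit (R := k) a * counit (R := k) v) • b ⊗ₜ[k] u := by
  have e : (innerCoords k A).toLinearMap =
      TensorProduct.map (tensorFst k A A).toLinearMap (tensorSnd k A A).toLinearMap ∘ₗ
        (TensorProduct.comm k _ _).toLinearMap := by
    rw [← map_snd_fst_comul, ← LinearMap.comp_assoc, ← TensorProduct.map_comp]
    rfl
  refine congr($e _).trans ?_
  simp [smul_tmul, tmul_smul, smul_smul]

theorem convL_innerCoords_tmul {F : (A ⊗[k] A) ⊗[k] (A ⊗[k] A) →ₗ[k] A ⊗[k] A}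
    {f : A ⊗[k] A →ₗ[k] A ⊗[k] A}
    (hF : ∀ a u b v : A, F ((a ⊗ₜ u) ⊗ₜ (b ⊗ₜ v)) = (a ⊗ₜ 1) * f (b ⊗ₜ u) * (1 ⊗ₜ v))
    (s : A ⊗[k] A →ₗ[k] k) (a u b v : A) :
    convL (s ∘ₗ (innerCoords k A).toLinearMap) F ((a ⊗ₜ u) ⊗ₜ (b ⊗ₜ v)) =
      (a ⊗ₜ 1) * conv (Algebra.linearMap k (A ⊗[k] A) ∘ₗ s) f (b ⊗ₜ u) * (1 ⊗ₜ v) := by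
  have e : ∀ a u b v : A ⊗[k] A,
      TensorProduct.lid k (A ⊗[k] A) (TensorProduct.map (s ∘ₗ (innerCoords k A).toLinearMap) F
        (AlgebraTensorModule.tensorTensorTensorComm k k k k _ _ _ _
          (AlgebraTensorModule.tensorTensorTensorComm k k k k A A A A (a ⊗ₜ u) ⊗ₜ
            AlgebraTensorModule.tensorTensorTensorComm k k k k A A A A (b ⊗ₜ v)))) =
      (TensorProduct.lid k A (rTensor A counit a) ⊗ₜ 1) *
        mul' k (A ⊗[k] A) (TensorProduct.map (Algebra.linearMap k (A ⊗[k] A) ∘ₗ s) f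
          (AlgebraTensorModule.tensorTensorTensorComm k k k k A A A A (b ⊗ₜ u))) *
        (1 ⊗ₜ TensorProduct.lid k A (rTensor A counit v)) := by
    intro a u b v
    induction a with
    | zero => simp
    | add => simp_all [add_tmul, add_mul]
    | tmul a₁ a₂ =>
    induction u with
    | zero => simp
    | add => simp_all [add_tmul, tmul_add, mul_add, add_mul]
    | tmul u₁ u₂ =>
    induction b with
    | zero => simp
    | add => simp_all [add_tmul, tmul_add, mul_add, add_mul]
    | tmul b₁ b₂ =>
    induction v with
    | zero => simp
    | add => simp_all [tmul_add, mul_add]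
    | tmul v₁ v₂ =>
      simp [innerCoords_tmul, hF, ← smul_tmul', tmul_smul, smul_smul, mul_assoc, mul_comm,
        mul_left_comm, Algebra.algebraMap_eq_smul_one,
        -Algebra.TensorProduct.algebraMap_apply]
  refine Eq.trans ?_ ((e (comul a) (comul u) (comul b) (comul v)).trans ?_)
  · simp [convL]
  · simp [conv]

theorem convR_innerCoords_tmul {F : (A ⊗[k] A) ⊗[k] (A ⊗[k] A) →ₗ[k] A ⊗[k] A}
    {f : A ⊗[k] A →ₗ[k] A ⊗[k] A}
    (hF : ∀ a u b v : A, F ((a ⊗ₜ u) ⊗ₜ (b ⊗ₜ v)) = (a ⊗ₜ 1) * f (b ⊗ₜ u) * (1 ⊗ₜ v))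
    (s : A ⊗[k] A →ₗ[k] k) (a u b v : A) :
    convR F (s ∘ₗ (innerCoords k A).toLinearMap) ((a ⊗ₜ u) ⊗ₜ (b ⊗ₜ v)) =
      (a ⊗ₜ 1) * conv f (Algebra.linearMap k (A ⊗[k] A) ∘ₗ s) (b ⊗ₜ u) * (1 ⊗ₜ v) := by
  have e : ∀ a u b v : A ⊗[k] A,
      TensorProduct.rid k (A ⊗[k] A) (TensorProduct.map F (s ∘ₗ (innerCoords k A).toLinearMap)
        (AlgebraTensorModule.tensorTensorTensorComm k k k k _ _ _ _
          (AlgebraTensorModule.tensorTensorTensorComm k k k k A A A A (a ⊗ₜ u) ⊗ₜ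
            AlgebraTensorModule.tensorTensorTensorComm k k k k A A A A (b ⊗ₜ v)))) =
      (TensorProduct.rid k A (lTensor A counit a) ⊗ₜ 1) *
        mul' k (A ⊗[k] A) (TensorProduct.map f (Algebra.linearMap k (A ⊗[k] A) ∘ₗ s)
          (AlgebraTensorModule.tensorTensorTensorComm k k k k A A A A (b ⊗ₜ u))) *
        (1 ⊗ₜ TensorProduct.rid k A (lTensor A counit v)) := by
    intro a u b v
    induction a with
    | zero => simp
    | add => simp_all [add_tmul, add_mul]
    | tmul a₁ a₂ =>
    induction u with
    | zero => simp
    | add => simp_all [add_tmul, tmul_add, mul_add, add_mul]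
    | tmul u₁ u₂ =>
    induction b with
    | zero => simp
    | add => simp_all [add_tmul, tmul_add, mul_add, add_mul]
    | tmul b₁ b₂ =>
    induction v with
    | zero => simp
    | add => simp_all [tmul_add, mul_add]
    | tmul v₁ v₂ =>
      simp [innerCoords_tmul, hF, ← smul_tmul', tmul_smul, smul_smul, mul_assoc, mul_comm,
        mul_left_comm, Algebra.algebraMap_eq_smul_one,
        -Algebra.TensorProduct.algebraMap_apply]
  refine Eq.trans ?_ ((e (comul a) (comul u) (comul b) (comul v)).trans ?_)
  · simp [convR]
  · simp [conv]

/-- The double multiplication is a conjugate of the tensor product multiplication. -/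
theorem doubleMul_eq {β βi : A ⊗[k] A →ₗ[k] k}
    {mulD : (A ⊗[k] A) ⊗[k] (A ⊗[k] A) →ₗ[k] A ⊗[k] A}
    (hmulD : ∀ a u b v : A, mulD ((a ⊗ₜ u) ⊗ₜ (b ⊗ₜ v)) =
      (a ⊗ₜ (1 : A)) * doubleInner β βi (b ⊗ₜ u) * ((1 : A) ⊗ₜ v)) :
    mulD = convR (convL (β ∘ₗ (innerCoords k A).toLinearMap) (mul' k (A ⊗[k] A)))
      (βi ∘ₗ (innerCoords k A).toLinearMap) := by
  ext a u b v
  exact (hmulD a u b v).trans (convR_innerCoords_tmul (convL_innerCoords_tmul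
    (f := LinearMap.id) (fun a u b v => by simp) β) βi a u b v).symm

end Double

section DoubleBraid

open WithConv

variable {C : Type} [AddCommGroup C] [Module k C] [Coalgebra k C]

/-- The pullback of the form `γ` along a pair of cocommuting coalgebra maps to the double. -/
def doubleBraid (β : (WithConv (A ⊗[k] A →ₗ[k] k))ˣ) (x y : C →ₗc[k] A ⊗[k] A)
    (h : Cocommute x y) : (WithConv (C →ₗ[k] k))ˣ :=
  braid β _ _ (h.map (tensorFst k A A) (tensorSnd k A A)) *
    braid β _ _ (h.map (tensorFst k A A) (tensorFst k A A)) *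
    (braid β _ _ (h.symm.map (tensorSnd k A A) (tensorSnd k A A)))⁻¹ *
    (braid β _ _ (h.symm.map (tensorFst k A A) (tensorSnd k A A)))⁻¹

variable {β : (WithConv (A ⊗[k] A →ₗ[k] k))ˣ}

theorem pullback_pair_gammaForm (hβ : IsSkewPairing β.val.ofConv) {x y : C →ₗc[k] A ⊗[k] A}
    (h : Cocommute x y) :
    pullback (pair x y h) (toConv (gammaForm β.val.ofConv β⁻¹.val.ofConv)) =
      (doubleBraid β x y h).val := by
  have hx := pair_self x
  have hy := pair_self y
  have h' : Cocommute (pair _ _ (cocommute_fst_snd.comp x))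
    (pair _ _ (cocommute_fst_snd.comp y)) := by rwa [← hx, ← hy]
  rw [doubleBraid, ← pullback_gammaForm hβ (cocommute_fst_snd.comp x) (cocommute_fst_snd.comp y)
    _ _ _ _ h']
  simp only [← hx, ← hy]

theorem doubleBraid_mul_left (hβ : IsBraiding β.val.ofConv) {x y z : C →ₗc[k] A ⊗[k] A}
    (hxy : Cocommute x y) (hxz : Cocommute x z) (hyz : Cocommute y z) :
    let b := braid β _ _ (hxy.symm.map (tensorFst k A A) (tensorSnd k A A))
    b * doubleBraid β (pairMul x y hxy) z
        (hxy.pairMul_left hxz hyz) * b⁻¹ =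
      doubleBraid β x z hxz * doubleBraid β y z hyz := by
  intro b
  simp only [doubleBraid, tensorFst_comp_pairMul, tensorSnd_comp_pairMul]
  rw [braid_pairMul_left hβ.skew (hxy.map _ _) (hxz.map _ _) (hyz.map _ _),
    braid_pairMul_left hβ.skew (hxy.map _ _) (hxz.map _ _) (hyz.map _ _),
    braid_pairMul_right hβ.skew (hxy.map _ _) (hxz.symm.map _ _) (hyz.symm.map _ _),
    braid_pairMul_right hβ.skew (hxy.map _ _) (hxz.symm.map _ _) (hyz.symm.map _ _)]
  have x' := cocommute_fst_snd.comp x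
  have y' := cocommute_fst_snd.comp y
  have z' := cocommute_fst_snd.comp z
  refine Commute.conj_mul_eq_of_braid_left
    (braid_braid_braid hβ (hyz.map (tensorFst k A A) (tensorSnd k A A)) (hxy.symm.map _ _)
      (hxz.symm.map _ (tensorSnd k A A)))
    (braid_braid_braid hβ (hyz.map (tensorFst k A A) (tensorFst k A A)) (hxy.symm.map _ _)
      (hxz.symm.map _ (tensorSnd k A A)))
    ?_ ?_ ?_ ?_ ?_ ?_ ?_ ?_
  all_goals
    apply commute_braid
    all_goals with_reducible first
      | exact hxy.map _ _ | exact hxz.map _ _ | exact hyz.map _ _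
      | exact hxy.symm.map _ _ | exact hxz.symm.map _ _ | exact hyz.symm.map _ _
      | exact x' | exact y' | exact z' | exact x'.symm | exact y'.symm | exact z'.symm

theorem doubleBraid_mul_right (hβ : IsBraiding β.val.ofConv) {x y z : C →ₗc[k] A ⊗[k] A}
    (hxy : Cocommute x y) (hxz : Cocommute x z) (hyz : Cocommute y z) :
    let b := braid β _ _ (hyz.symm.map (tensorFst k A A) (tensorSnd k A A))
    b * doubleBraid β x (pairMul y z hyz)
        (hyz.pairMul_right hxy hxz) * b⁻¹ =
      doubleBraid β x z hxz * doubleBraid β x y hxy := by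
  intro b
  simp only [doubleBraid, tensorFst_comp_pairMul, tensorSnd_comp_pairMul]
  rw [braid_pairMul_right hβ.skew (hyz.map _ _) (hxy.map _ _) (hxz.map _ _),
    braid_pairMul_right hβ.skew (hyz.map _ _) (hxy.map _ _) (hxz.map _ _),
    braid_pairMul_left hβ.skew (hyz.map _ _) (hxy.symm.map _ _) (hxz.symm.map _ _),
    braid_pairMul_left hβ.skew (hyz.map _ _) (hxy.symm.map _ _) (hxz.symm.map _ _)]
  have x' := cocommute_fst_snd.comp x
  have y' := cocommute_fst_snd.comp y
  have z' := cocommute_fst_snd.comp z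
  refine Commute.conj_mul_eq_of_braid_right
    (braid_braid_braid hβ (hxz.map (tensorFst k A A) (tensorFst k A A)) (hxy.map _ _)
      (hyz.symm.map _ (tensorSnd k A A)))
    (braid_braid_braid hβ (hyz.symm.map (tensorFst k A A) (tensorSnd k A A)) (hxz.symm.map _ _)
      (hxy.symm.map _ (tensorSnd k A A)))
    ?_ ?_ ?_ ?_ ?_ ?_ ?_ ?_
  all_goals
    apply commute_braid
    all_goals with_reducible first
      | exact hxy.map _ _ | exact hxz.map _ _ | exact hyz.map _ _
      | exact hxy.symm.map _ _ | exact hxz.symm.map _ _ | exact hyz.symm.map _ _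
      | exact x' | exact y' | exact z' | exact x'.symm | exact y'.symm

end DoubleBraid

section DoubleClauses

open WithConv

variable {β : (WithConv (A ⊗[k] A →ₗ[k] k))ˣ}

theorem isConvInvertible_of_unit {C : Type} [AddCommGroup C] [Module k C] [Coalgebra k C]
    (u : (WithConv (C →ₗ[k] k))ˣ) : IsConvInvertible u.val.ofConv :=
  ⟨u⁻¹.val.ofConv, congr(($(u.mul_inv)).ofConv), congr(($(u.inv_mul)).ofConv)⟩

theorem toConv_gammaForm (hβ : IsSkewPairing β.val.ofConv) :
    toConv (gammaForm β.val.ofConv β⁻¹.val.ofConv) =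
      (doubleBraid β (tensorFst k (A ⊗[k] A) (A ⊗[k] A)) (tensorSnd k (A ⊗[k] A) (A ⊗[k] A))
        cocommute_fst_snd).val := by
  rw [← pullback_pair_gammaForm hβ, pair_tensorFst_tensorSnd]
  rfl

theorem pullback_map_gammaForm {X Y : Type} [AddCommGroup X] [Module k X] [Coalgebra k X]
    [AddCommGroup Y] [Module k Y] [Coalgebra k Y] (hβ : IsSkewPairing β.val.ofConv)
    (f : X →ₗc[k] A ⊗[k] A) (g : Y →ₗc[k] A ⊗[k] A) :
    pullback (Coalgebra.TensorProduct.map f g)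
      (toConv (gammaForm β.val.ofConv β⁻¹.val.ofConv)) =
      (doubleBraid β (f.comp (tensorFst k X Y)) (g.comp (tensorSnd k X Y))
        (cocommute_fst_snd.map f g)).val := by
  rw [map_eq_pair, pullback_pair_gammaForm hβ]

theorem mulCoalgHom_comp {C : Type} [AddCommGroup C] [Module k C] [Coalgebra k C]
    (f : C →ₗc[k] A ⊗[k] A) :
    (Bialgebra.mulCoalgHom k A).comp f =
      pairMul ((tensorFst k A A).comp f) ((tensorSnd k A A).comp f)
        (cocommute_fst_snd.comp f) := by
  rw [pairMul, ← pair_self]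

theorem apply_mul_tmul {X Z : Type} [AddCommGroup X] [Module k X] [Coalgebra k X] [AddCommGroup Z]
    [Module k Z] [Coalgebra k Z] {m : X ⊗[k] X →ₗ[k] X} {g : X ⊗[k] Z →ₗ[k] k}
    (h : toConv (g ∘ₗ rTensor Z m) =
      pullback (Coalgebra.TensorProduct.map (tensorFst k X X) (CoalgHom.id k Z)) (toConv g) *
        pullback (Coalgebra.TensorProduct.map (tensorSnd k X X) (CoalgHom.id k Z)) (toConv g))
    (x y : X) (z : Z) :
    g (m (x ⊗ₜ y) ⊗ₜ z) =
      conv (g ∘ₗ TensorProduct.mk k X Z x) (g ∘ₗ TensorProduct.mk k X Z y) z := by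
  rw [← pullback_mul_pullback_tmul_left, ← h]
  rfl

theorem apply_tmul_mul {X Z : Type} [AddCommGroup X] [Module k X] [Coalgebra k X] [AddCommGroup Z]
    [Module k Z] [Coalgebra k Z] {m : Z ⊗[k] Z →ₗ[k] Z} {g : X ⊗[k] Z →ₗ[k] k}
    (h : toConv (g ∘ₗ lTensor X m) =
      pullback (Coalgebra.TensorProduct.map (CoalgHom.id k X) (tensorSnd k Z Z)) (toConv g) *
        pullback (Coalgebra.TensorProduct.map (CoalgHom.id k X) (tensorFst k Z Z)) (toConv g))
    (x : X) (y z : Z) :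
    g (x ⊗ₜ m (y ⊗ₜ z)) =
      conv (g ∘ₗ (TensorProduct.mk k X Z).flip z) (g ∘ₗ (TensorProduct.mk k X Z).flip y) x := by
  rw [← pullback_mul_pullback_tmul_right, ← h]
  rfl

theorem toConv_comp_rTensor_mul {X Z : Type} [Ring X] [Bialgebra k X] [AddCommGroup Z] [Module k Z]
    [Coalgebra k Z] (g : X ⊗[k] Z →ₗ[k] k) :
    toConv (g ∘ₗ rTensor Z (mul' k X)) = pullback
      (Coalgebra.TensorProduct.map (Bialgebra.mulCoalgHom k X) (CoalgHom.id k Z)) (toConv g) :=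
  rfl

theorem toConv_comp_lTensor_mul {X Z : Type} [AddCommGroup X] [Module k X] [Coalgebra k X] [Ring Z]
    [Bialgebra k Z] (g : X ⊗[k] Z →ₗ[k] k) :
    toConv (g ∘ₗ lTensor X (mul' k Z)) = pullback
      (Coalgebra.TensorProduct.map (CoalgHom.id k X) (Bialgebra.mulCoalgHom k Z)) (toConv g) :=
  rfl

variable {mulD : (A ⊗[k] A) ⊗[k] (A ⊗[k] A) →ₗ[k] A ⊗[k] A}

theorem pullback_innerCoords {C : Type} [AddCommGroup C] [Module k C] [Coalgebra k C]
    (w : C →ₗc[k] (A ⊗[k] A) ⊗[k] (A ⊗[k] A)) (g : WithConv (A ⊗[k] A →ₗ[k] k)) :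
    pullback w (pullback (innerCoords k A) g) =
      pullback (pair _ _ ((cocommute_fst_snd.comp w).symm.map (tensorFst k A A)
        (tensorSnd k A A))) g := by
  rw [pullback_pullback, innerCoords, pair_comp]
  rfl

theorem doubleBraid_mulCoalgHom_left (hβ : IsBraiding β.val.ofConv) {C : Type} [AddCommGroup C]
    [Module k C] [Coalgebra k C] {w : C →ₗc[k] (A ⊗[k] A) ⊗[k] (A ⊗[k] A)}
    {z : C →ₗc[k] A ⊗[k] A} (h : Cocommute w z)
    (hwz : Cocommute ((Bialgebra.mulCoalgHom k (A ⊗[k] A)).comp w) z) :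
    pullback w (pullback (innerCoords k A) β.val) * doubleBraid β _ z hwz *
        pullback w (pullback (innerCoords k A) β⁻¹.val) =
      doubleBraid β _ _ (h.map (tensorFst k _ _) (CoalgHom.id k _)) *
        doubleBraid β _ _ (h.map (tensorSnd k _ _) (CoalgHom.id k _)) := by
  have e := congrArg Units.val (doubleBraid_mul_left hβ (cocommute_fst_snd.comp w)
    (h.map (tensorFst k _ _) (CoalgHom.id k _)) (h.map (tensorSnd k _ _) (CoalgHom.id k _)))
  rw [pullback_innerCoords, pullback_innerCoords]
  simp only [mulCoalgHom_comp]
  exact e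

theorem doubleBraid_mulCoalgHom_right (hβ : IsBraiding β.val.ofConv) {C : Type} [AddCommGroup C]
    [Module k C] [Coalgebra k C] {x : C →ₗc[k] A ⊗[k] A}
    {w : C →ₗc[k] (A ⊗[k] A) ⊗[k] (A ⊗[k] A)} (h : Cocommute x w)
    (hxw : Cocommute x ((Bialgebra.mulCoalgHom k (A ⊗[k] A)).comp w)) :
    pullback w (pullback (innerCoords k A) β.val) * doubleBraid β x _ hxw *
        pullback w (pullback (innerCoords k A) β⁻¹.val) =
      doubleBraid β _ _ (h.map (CoalgHom.id k _) (tensorSnd k _ _)) *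
        doubleBraid β _ _ (h.map (CoalgHom.id k _) (tensorFst k _ _)) := by
  have e := congrArg Units.val (doubleBraid_mul_right hβ
    (h.map (CoalgHom.id k _) (tensorFst k _ _)) (h.map (CoalgHom.id k _) (tensorSnd k _ _))
    (cocommute_fst_snd.comp w))
  rw [pullback_innerCoords, pullback_innerCoords]
  simp only [mulCoalgHom_comp]
  exact e

theorem gammaForm_mul_left (hβ : IsBraiding β.val.ofConv)
    (hD : mulD = convR (convL (β.val.ofConv ∘ₗ (innerCoords k A).toLinearMap)
      (mul' k (A ⊗[k] A))) (β⁻¹.val.ofConv ∘ₗ (innerCoords k A).toLinearMap))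
    (x y z : A ⊗[k] A) :
    gammaForm β.val.ofConv β⁻¹.val.ofConv (mulD (x ⊗ₜ y) ⊗ₜ z) =
      conv (gammaForm β.val.ofConv β⁻¹.val.ofConv ∘ₗ TensorProduct.mk k _ _ x)
        (gammaForm β.val.ofConv β⁻¹.val.ofConv ∘ₗ TensorProduct.mk k _ _ y) z := by
  refine apply_mul_tmul ?_ x y z
  rw [hD, toConv_comp_rTensor_convR, toConv_comp_rTensor_convL, toConv_comp_rTensor_mul,
    pullback_map_gammaForm hβ.skew (Bialgebra.mulCoalgHom k (A ⊗[k] A)) (CoalgHom.id k (A ⊗[k] A)),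
    pullback_map_gammaForm hβ.skew (tensorFst k (A ⊗[k] A) (A ⊗[k] A)) (CoalgHom.id k (A ⊗[k] A)),
    pullback_map_gammaForm hβ.skew (tensorSnd k (A ⊗[k] A) (A ⊗[k] A)) (CoalgHom.id k (A ⊗[k] A))]
  exact doubleBraid_mulCoalgHom_left hβ cocommute_fst_snd _

theorem gammaForm_mul_right (hβ : IsBraiding β.val.ofConv)
    (hD : mulD = convR (convL (β.val.ofConv ∘ₗ (innerCoords k A).toLinearMap)
      (mul' k (A ⊗[k] A))) (β⁻¹.val.ofConv ∘ₗ (innerCoords k A).toLinearMap))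
    (x y z : A ⊗[k] A) :
    gammaForm β.val.ofConv β⁻¹.val.ofConv (x ⊗ₜ mulD (y ⊗ₜ z)) =
      conv (gammaForm β.val.ofConv β⁻¹.val.ofConv ∘ₗ (TensorProduct.mk k _ _).flip z)
        (gammaForm β.val.ofConv β⁻¹.val.ofConv ∘ₗ (TensorProduct.mk k _ _).flip y) x := by
  refine apply_tmul_mul ?_ x y z
  rw [hD, toConv_comp_lTensor_convR, toConv_comp_lTensor_convL, toConv_comp_lTensor_mul,
    pullback_map_gammaForm hβ.skew, pullback_map_gammaForm hβ.skew,
    pullback_map_gammaForm hβ.skew]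
  exact doubleBraid_mulCoalgHom_right hβ cocommute_fst_snd _

theorem unitBialgHom_eq_smul_one (r : k) : Bialgebra.unitBialgHom k A r = r • 1 :=
  Algebra.algebraMap_eq_smul_one r

theorem braid_unit_left (hβ : IsSkewPairing β.val.ofConv) {C : Type} [AddCommGroup C] [Module k C]
    [Coalgebra k C] (e : C →ₗc[k] k) (q : C →ₗc[k] A)
    (h : Cocommute ((Bialgebra.unitBialgHom k A : k →ₗc[k] A).comp e) q) :
    braid β _ q h = 1 := by
  have e' : β.val.ofConv ∘ₗ TensorProduct.map
        ((Bialgebra.unitBialgHom k A : k →ₗc[k] A).comp e).toLinearMap q.toLinearMap =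
      counit ∘ₗ TensorProduct.map
        ((Bialgebra.unitBialgHom k A : k →ₗc[k] A).comp e).toLinearMap q.toLinearMap := by
    ext x y
    simp [unitBialgHom_eq_smul_one, ← smul_tmul', hβ.one_left, mul_comm]
  ext c
  exact congr($e' (comul c)).trans (CoalgHomClass.counit_comp_apply (pair _ q h) c)

theorem braid_unit_right (hβ : IsSkewPairing β.val.ofConv) {C : Type} [AddCommGroup C] [Module k C]
    [Coalgebra k C] (p : C →ₗc[k] A) (e : C →ₗc[k] k)
    (h : Cocommute p ((Bialgebra.unitBialgHom k A : k →ₗc[k] A).comp e)) :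
    braid β p _ h = 1 := by
  have e' : β.val.ofConv ∘ₗ TensorProduct.map p.toLinearMap
        ((Bialgebra.unitBialgHom k A : k →ₗc[k] A).comp e).toLinearMap =
      counit ∘ₗ TensorProduct.map p.toLinearMap
        ((Bialgebra.unitBialgHom k A : k →ₗc[k] A).comp e).toLinearMap := by
    ext x y
    simp [unitBialgHom_eq_smul_one, hβ.one_right]
  ext c
  exact congr($e' (comul c)).trans (CoalgHomClass.counit_comp_apply (pair p _ h) c)

theorem tensorFst_comp_unit : (tensorFst k A A).comp (Bialgebra.unitBialgHom k (A ⊗[k] A)) =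
    (Bialgebra.unitBialgHom k A : k →ₗc[k] A) := by
  apply CoalgHom.coe_linearMap_injective
  ext
  simp [Algebra.TensorProduct.one_def]

theorem tensorSnd_comp_unit : (tensorSnd k A A).comp (Bialgebra.unitBialgHom k (A ⊗[k] A)) =
    (Bialgebra.unitBialgHom k A : k →ₗc[k] A) := by
  apply CoalgHom.coe_linearMap_injective
  ext
  simp [Algebra.TensorProduct.one_def]

theorem gammaForm_one_left (hβ : IsSkewPairing β.val.ofConv) (x : A ⊗[k] A) :
    gammaForm β.val.ofConv β⁻¹.val.ofConv (1 ⊗ₜ x) = counit (R := k) x := by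
  have e := pullback_map_gammaForm hβ (Bialgebra.unitBialgHom k (A ⊗[k] A) : k →ₗc[k] A ⊗[k] A)
    (CoalgHom.id k (A ⊗[k] A))
  simp only [doubleBraid, ← CoalgHom.comp_assoc, tensorFst_comp_unit, tensorSnd_comp_unit,
    braid_unit_left hβ, braid_unit_right hβ, inv_one, mul_one, Units.val_one] at e
  have := congr(($e).ofConv (1 ⊗ₜ x))
  simpa [pullback, LinearMap.convOne_def] using this

theorem gammaForm_one_right (hβ : IsSkewPairing β.val.ofConv) (x : A ⊗[k] A) :
    gammaForm β.val.ofConv β⁻¹.val.ofConv (x ⊗ₜ 1) = counit (R := k) x := by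
  have e := pullback_map_gammaForm hβ (CoalgHom.id k (A ⊗[k] A))
    (Bialgebra.unitBialgHom k (A ⊗[k] A) : k →ₗc[k] A ⊗[k] A)
  simp only [doubleBraid, ← CoalgHom.comp_assoc, tensorFst_comp_unit, tensorSnd_comp_unit,
    braid_unit_left hβ, braid_unit_right hβ, inv_one, mul_one, Units.val_one] at e
  have := congr(($e).ofConv (x ⊗ₜ 1))
  simpa [pullback, LinearMap.convOne_def] using this

section Compat

variable {C : Type} [AddCommGroup C] [Module k C] [Coalgebra k C]

/-- A scalar convolution unit, regarded as a convolution unit with values in an algebra. -/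
abbrev scalarUnit (R : Type) [Ring R] [Algebra k R] :
    (WithConv (C →ₗ[k] k))ˣ →* (WithConv (C →ₗ[k] R))ˣ :=
  Units.map (pushforward (Algebra.ofId k R))

theorem pullback_doubleMul
    (hD : mulD = convR (convL (β.val.ofConv ∘ₗ (innerCoords k A).toLinearMap)
      (mul' k (A ⊗[k] A))) (β⁻¹.val.ofConv ∘ₗ (innerCoords k A).toLinearMap))
    {x y : C →ₗc[k] A ⊗[k] A} (h : Cocommute x y) :
    let u := scalarUnit (A ⊗[k] A)
      (braid β _ _ (h.symm.map (tensorFst k A A) (tensorSnd k A A)))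
    pullback (pair x y h) (toConv mulD) =
      u * (toConv x.toLinearMap * toConv y.toLinearMap) * (u⁻¹).val := by
  intro u
  have e (g : WithConv (A ⊗[k] A →ₗ[k] k)) :
      pullback (pair x y h) (pullback (innerCoords k A) g) =
        pullback (pair _ _ (h.symm.map (tensorFst k A A) (tensorSnd k A A))) g := by
    rw [pullback_innerCoords]
    simp only [fst_comp_pair, snd_comp_pair]
  rw [hD, toConv_convR, toConv_convL, map_mul, map_mul]
  refine congrArg₂ (· * ·) (congrArg₂ (· * ·) ?_ rfl) ?_
  · exact congr(pushforward (Algebra.ofId k (A ⊗[k] A)) $(e β.val))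
  · exact congr(pushforward (Algebra.ofId k (A ⊗[k] A)) $(e β⁻¹.val))

theorem toConv_eq_includeLeft_mul_includeRight (x : C →ₗc[k] A ⊗[k] A) :
    toConv x.toLinearMap =
      pushforward Algebra.TensorProduct.includeLeft
          (toConv ((tensorFst k A A).comp x).toLinearMap) *
        pushforward Algebra.TensorProduct.includeRight
          (toConv ((tensorSnd k A A).comp x).toLinearMap) := by
  have e : mul' k (A ⊗[k] A) ∘ₗ TensorProduct.map
      (Algebra.TensorProduct.includeLeft (R := k) (S := k) (A := A) (B := A)).toLinearMap
      (Algebra.TensorProduct.includeRight (R := k) (A := A) (B := A)).toLinearMap =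
      LinearMap.id := by
    ext; simp
  apply WithConv.ext
  conv_lhs => rw [pair_self x]
  change TensorProduct.map _ _ ∘ₗ comul =
    mul' k (A ⊗[k] A) ∘ₗ TensorProduct.map (_ ∘ₗ _) (_ ∘ₗ _) ∘ₗ comul
  rw [TensorProduct.map_comp, ← LinearMap.comp_assoc, ← LinearMap.comp_assoc, e,
    LinearMap.id_comp]

theorem pushforward_compat (hβ : IsBraiding β.val.ofConv) {p q : C →ₗc[k] A}
    (h : Cocommute p q) (φ : A →ₐ[k] A ⊗[k] A) :
    pushforward φ (toConv q.toLinearMap) * pushforward φ (toConv p.toLinearMap) *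
        scalarUnit (A ⊗[k] A) (braid β p q h) =
      scalarUnit (A ⊗[k] A) (braid β p q h) *
        (pushforward φ (toConv p.toLinearMap) * pushforward φ (toConv q.toLinearMap)) := by
  have e : φ.comp (Algebra.ofId k A) = Algebra.ofId k (A ⊗[k] A) := Subsingleton.elim _ _
  have e' := congr(pushforward φ $(braid_compat hβ h))
  simp only [map_mul] at e'
  have e'' : pushforward φ (pushforward (Algebra.ofId k A) (braid β p q h).val) =
    (scalarUnit (A ⊗[k] A) (braid β p q h)).val := congr(pushforward $e (braid β p q h).val)
  rwa [e''] at e'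

theorem doubleMul_compat (hβ : IsBraiding β.val.ofConv)
    (hD : mulD = convR (convL (β.val.ofConv ∘ₗ (innerCoords k A).toLinearMap)
      (mul' k (A ⊗[k] A))) (β⁻¹.val.ofConv ∘ₗ (innerCoords k A).toLinearMap))
    {x y : C →ₗc[k] A ⊗[k] A} (h : Cocommute x y) :
    pullback (pair y x h.symm) (toConv mulD) * scalarUnit (A ⊗[k] A) (doubleBraid β x y h) =
      scalarUnit (A ⊗[k] A) (doubleBraid β x y h) * pullback (pair x y h) (toConv mulD) := by
  have comm {p q : C →ₗc[k] A} (h : Cocommute p q) :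
      Commute (pushforward (Algebra.TensorProduct.includeLeft (R := k) (S := k) (B := A))
          (toConv p.toLinearMap))
        (pushforward (Algebra.TensorProduct.includeRight (R := k) (A := A))
          (toConv q.toLinearMap)) :=
    h.commute (toConv (Algebra.TensorProduct.includeLeft (R := k) (S := k)).toLinearMap)
      (toConv (Algebra.TensorProduct.includeRight (R := k)).toLinearMap)
      fun a b => by simp [Commute, SemiconjBy]
  have scalar {p q r : C →ₗc[k] A} (hpq : Cocommute p q) (hpr : Cocommute p r)
      (hqr : Cocommute q r) (φ : A →ₐ[k] A ⊗[k] A) :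
      Commute (scalarUnit (A ⊗[k] A) (braid β p q hpq)).val
        (pushforward φ (toConv r.toLinearMap)) :=
    (hpq.pair_left hpr hqr).commute (pushforward (Algebra.ofId k (A ⊗[k] A)) β.val)
      (toConv φ.toLinearMap) fun a b => Algebra.commutes (β.val.ofConv a) (φ b)
  have x' := cocommute_fst_snd.comp x
  have y' := cocommute_fst_snd.comp y
  have ac := h.map (tensorFst k A A) (tensorFst k A A)
  have ad := h.map (tensorFst k A A) (tensorSnd k A A)
  have cb := h.symm.map (tensorFst k A A) (tensorSnd k A A)
  have db := h.symm.map (tensorSnd k A A) (tensorSnd k A A)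
  have e₁ := pullback_doubleMul hD h
  have e₂ := pullback_doubleMul hD h.symm
  rw [toConv_eq_includeLeft_mul_includeRight x, toConv_eq_includeLeft_mul_includeRight y] at e₁ e₂
  rw [(comm cb).symm.mul_mul_mul_comm] at e₁
  rw [(comm ad).symm.mul_mul_mul_comm] at e₂
  rw [e₁, e₂, doubleBraid, map_mul, map_mul, map_mul, map_inv, map_inv]
  exact Commute.conj_mul_eq_of_compat (pushforward_compat hβ ac _) (pushforward_compat hβ db _)
    ((scalar ac ad y' _).mul_right (scalar ac x' cb _))
    ((scalar db ad.symm x'.symm _).mul_right (scalar db y'.symm cb.symm _))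

theorem gammaForm_compat (hβ : IsBraiding β.val.ofConv)
    (hD : mulD = convR (convL (β.val.ofConv ∘ₗ (innerCoords k A).toLinearMap)
      (mul' k (A ⊗[k] A))) (β⁻¹.val.ofConv ∘ₗ (innerCoords k A).toLinearMap)) :
    toConv (convR (mulD ∘ₗ (TensorProduct.comm k (A ⊗[k] A) (A ⊗[k] A)).toLinearMap)
        (gammaForm β.val.ofConv β⁻¹.val.ofConv)) =
      toConv (convL (gammaForm β.val.ofConv β⁻¹.val.ofConv) mulD) := by
  have e := doubleMul_compat hβ hD (cocommute_fst_snd (k := k) (X := A ⊗[k] A) (Y := A ⊗[k] A))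
  rw [toConv_convR, toConv_convL, toConv_gammaForm hβ.skew]
  rw [pair_tensorFst_tensorSnd] at e
  refine Eq.trans (congrArg (· * _) (WithConv.ext ?_)) e
  exact congr(mulD ∘ₗ $(map_snd_fst_comul)).symm

end Compat

end DoubleClauses

theorem double_braiding (β : A ⊗[k] A →ₗ[k] k) (hβ : IsBraiding β)
    (βi : A ⊗[k] A →ₗ[k] k)
    (hinv₁ : conv β βi = Coalgebra.counit) (hinv₂ : conv βi β = Coalgebra.counit)
    -- the double multiplication (a⊗u)(b⊗v) = Σ β(b₁,u₁) ab₂ ⊗ u₂v β⁻¹(b₃,u₃)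
    (mulD : (A ⊗[k] A) ⊗[k] (A ⊗[k] A) →ₗ[k] A ⊗[k] A)
    (hmulD : ∀ a u b v : A,
      mulD ((a ⊗ₜ u) ⊗ₜ (b ⊗ₜ v))
        = (a ⊗ₜ (1 : A)) * doubleInner β βi (b ⊗ₜ u) * ((1 : A) ⊗ₜ v)) :
    -- γ is convolution-invertible,
    IsConvInvertible (gammaForm β βi) ∧
    -- γ is a skew pairing on (A ⋈ A, A ⋈ A) for the double multiplication:
    (∀ x y z : A ⊗[k] A,
      gammaForm β βi ((mulD (x ⊗ₜ y)) ⊗ₜ z)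
        = conv (gammaForm β βi ∘ₗ TensorProduct.mk k (A ⊗[k] A) (A ⊗[k] A) x)
            (gammaForm β βi ∘ₗ TensorProduct.mk k (A ⊗[k] A) (A ⊗[k] A) y) z) ∧
    (∀ x y z : A ⊗[k] A,
      gammaForm β βi (x ⊗ₜ (mulD (y ⊗ₜ z)))
        = conv (gammaForm β βi ∘ₗ (TensorProduct.mk k (A ⊗[k] A) (A ⊗[k] A)).flip z)
            (gammaForm β βi ∘ₗ (TensorProduct.mk k (A ⊗[k] A) (A ⊗[k] A)).flip y) x) ∧
    (∀ x : A ⊗[k] A,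
      gammaForm β βi ((((1 : A) ⊗ₜ (1 : A)) : A ⊗[k] A) ⊗ₜ x) = Coalgebra.counit x) ∧
    (∀ x : A ⊗[k] A,
      gammaForm β βi (x ⊗ₜ (((1 : A) ⊗ₜ (1 : A)) : A ⊗[k] A)) = Coalgebra.counit x) ∧
    -- Σ y₁x₁ γ(x₂,y₂) = Σ γ(x₁,y₁) x₂y₂ in A ⋈ A
    (∀ x y : A ⊗[k] A,
      convR (mulD ∘ₗ (TensorProduct.comm k (A ⊗[k] A) (A ⊗[k] A)).toLinearMap)
          (gammaForm β βi) (x ⊗ₜ y)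
        = convL (gammaForm β βi) mulD (x ⊗ₜ y)) := by
  obtain ⟨u, rfl, rfl⟩ : ∃ u : (WithConv (A ⊗[k] A →ₗ[k] k))ˣ,
      β = u.val.ofConv ∧ βi = u⁻¹.val.ofConv :=
    ⟨⟨WithConv.toConv β, WithConv.toConv βi, WithConv.ext hinv₁, WithConv.ext hinv₂⟩, rfl, rfl⟩
  have hD := doubleMul_eq hmulD
  refine ⟨?_, gammaForm_mul_left hβ hD, gammaForm_mul_right hβ hD, gammaForm_one_left hβ.skew,
    gammaForm_one_right hβ.skew, fun x y => ?_⟩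
  · exact congr(IsConvInvertible ($(toConv_gammaForm hβ.skew)).ofConv).mpr
      (isConvInvertible_of_unit _)
  · exact congr(($(gammaForm_compat hβ hD)).ofConv (x ⊗ₜ y))

end
end

section
/- Let (A,β) be a braided Hopf algebra over a field k. Then the multiplication map m : A ⋈ A → A, a ⊗ b ↦ ab, is a Hopf algebra homomorphism from the double A ⋈ A to A. In particular, for all a, b, a', b' ∈ A one has Σ β(a₁', b₁) a a₂' b₂ b' β⁻¹(a₃', b₃) = a b a' b'. -/
/-!
STATEMENT 8: Let (A,β) be a braided Hopf algebra over a field k.  Then the multiplication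
map m : A ⋈ A → A, a⊗b ↦ ab, is a Hopf algebra homomorphism from the double A ⋈ A to A.
In particular, Σ β(a₁', b₁) a a₂' b₂ b' β⁻¹(a₃', b₃) = a b a' b' for all a, b, a', b' ∈ A.
-/

open TensorProduct Coalgebra LinearMap

noncomputable section

variable {k : Type} [Field k]

variable {A : Type} [Ring A] [HopfAlgebra k A]

section Convolution

variable {C M N : Type} [AddCommGroup C] [Module k C] [Coalgebra k C]
  [AddCommGroup M] [Module k M] [AddCommGroup N] [Module k N]

theorem comp_convL (h : M →ₗ[k] N) (g : C →ₗ[k] k) (f : C →ₗ[k] M) :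
    h ∘ₗ convL g f = convL g (h ∘ₗ f) := by
  ext c
  simp only [convL, LinearMap.comp_apply]
  generalize comul (R := k) c = t
  induction t <;> simp_all

theorem comp_convR (h : M →ₗ[k] N) (f : C →ₗ[k] M) (g : C →ₗ[k] k) :
    h ∘ₗ convR f g = convR (h ∘ₗ f) g := by
  ext c
  simp only [convR, LinearMap.comp_apply]
  generalize comul (R := k) c = t
  induction t <;> simp_all

theorem conv_algebraMap_left {B : Type} [Ring B] [Algebra k B] (g : C →ₗ[k] k)
    (f : C →ₗ[k] B) : conv (Algebra.linearMap k B ∘ₗ g) f = convL g f := by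
  ext c
  simp only [conv, convL, LinearMap.comp_apply]
  generalize comul (R := k) c = t
  induction t <;> simp_all [Algebra.smul_def]

theorem conv_algebraMap_right {B : Type} [Ring B] [Algebra k B] (f : C →ₗ[k] B)
    (g : C →ₗ[k] k) : conv f (Algebra.linearMap k B ∘ₗ g) = convR f g := by
  ext c
  simp only [conv, convR, LinearMap.comp_apply]
  generalize comul (R := k) c = t
  induction t <;> simp_all [Algebra.smul_def, Algebra.commutes]

theorem convR_counit (f : C →ₗ[k] M) : convR f counit = f := by
  ext c
  have h : TensorProduct.map f counit (comul (R := k) c) = f c ⊗ₜ[k] 1 := by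
    rw [← LinearMap.rTensor_comp_lTensor, LinearMap.comp_apply, lTensor_counit_comul,
      LinearMap.rTensor_tmul]
  simp [convR, h]

theorem convR_convR (f : C →ₗ[k] M) (g g' : C →ₗ[k] k) :
    convR (convR f g) g' = convR f (conv g g') := by
  have assoc_eval : ∀ t : (C ⊗[k] C) ⊗[k] C,
      TensorProduct.rid k M (TensorProduct.map
        ((TensorProduct.rid k M).toLinearMap ∘ₗ TensorProduct.map f g) g' t) =
      TensorProduct.rid k M (TensorProduct.map f
        (LinearMap.mul' k k ∘ₗ TensorProduct.map g g') (TensorProduct.assoc k C C C t)) := by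
    intro t
    induction t with
    | zero => simp
    | add x y hx hy => simp_all
    | tmul x c =>
      induction x with
      | zero => simp
      | add x y hx hy => simp_all [add_tmul]
      | tmul a b => simp [smul_smul, mul_comm]
  ext c
  have h := assoc_eval (comul.rTensor C (comul (R := k) c))
  rw [coassoc_apply] at h
  simp only [LinearMap.rTensor, LinearMap.lTensor, ← LinearMap.comp_apply,
    ← LinearMap.comp_assoc, ← TensorProduct.map_comp, LinearMap.comp_id] at h
  exact h

end Convolution

theorem doubleInner_eq_convR_convL (β βi : A ⊗[k] A →ₗ[k] k) :
    doubleInner β βi = convR (convL β LinearMap.id) βi := by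
  rw [doubleInner, conv_algebraMap_left, conv_algebraMap_right]

theorem mul'_doubleInner {β βi : A ⊗[k] A →ₗ[k] k} (hβ : IsBraiding β)
    (hinv : conv β βi = Coalgebra.counit) (b u : A) :
    LinearMap.mul' k A (doubleInner β βi (b ⊗ₜ u)) = u * b := by
  have compat : convR (LinearMap.mul' k A ∘ₗ (TensorProduct.comm k A A).toLinearMap) β =
      convL β (LinearMap.mul' k A) := TensorProduct.ext' hβ.compat
  rw [← LinearMap.comp_apply, doubleInner_eq_convR_convL, comp_convR, comp_convL,
    LinearMap.comp_id, ← compat, convR_convR, hinv, convR_counit]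
  simp

theorem mul'_tmul_one_mul_mul_one_tmul (a v : A) (t : A ⊗[k] A) :
    LinearMap.mul' k A ((a ⊗ₜ (1 : A)) * t * ((1 : A) ⊗ₜ v)) =
      a * LinearMap.mul' k A t * v := by
  induction t with
  | zero => simp
  | add x y hx hy => simp only [mul_add, add_mul, map_add, hx, hy]
  | tmul x y => simp [mul_assoc]

theorem mul_hopfHom_of_double (β : A ⊗[k] A →ₗ[k] k) (hβ : IsBraiding β)
    (βi : A ⊗[k] A →ₗ[k] k)
    (hinv₁ : conv β βi = Coalgebra.counit) (hinv₂ : conv βi β = Coalgebra.counit)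
    -- the double multiplication (a⊗u)(b⊗v) = Σ β(b₁,u₁) ab₂ ⊗ u₂v β⁻¹(b₃,u₃)
    (mulD : (A ⊗[k] A) ⊗[k] (A ⊗[k] A) →ₗ[k] A ⊗[k] A)
    (hmulD : ∀ a u b v : A,
      mulD ((a ⊗ₜ u) ⊗ₜ (b ⊗ₜ v))
        = (a ⊗ₜ (1 : A)) * doubleInner β βi (b ⊗ₜ u) * ((1 : A) ⊗ₜ v)) :
    -- m is an algebra homomorphism from A ⋈ A to A:
    (∀ x y : A ⊗[k] A,
      LinearMap.mul' k A (mulD (x ⊗ₜ y)) = LinearMap.mul' k A x * LinearMap.mul' k A y) ∧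
    (LinearMap.mul' k A ((((1 : A) ⊗ₜ (1 : A)) : A ⊗[k] A)) = 1) ∧
    -- m is a coalgebra homomorphism:
    ((Coalgebra.comul (R := k)) ∘ₗ (LinearMap.mul' k A)
        = TensorProduct.map (LinearMap.mul' k A) (LinearMap.mul' k A)
            ∘ₗ (Coalgebra.comul (R := k) (A := (A ⊗[k] A)))) ∧
    ((Coalgebra.counit (R := k)) ∘ₗ (LinearMap.mul' k A)
        = (Coalgebra.counit (R := k) (A := (A ⊗[k] A)))) ∧
    -- in particular Σ β(a₁',b₁) a a₂' b₂ b' β⁻¹(a₃',b₃) = a b a' b':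
    (∀ a b a' b' : A,
      a * LinearMap.mul' k A (doubleInner β βi (a' ⊗ₜ b)) * b' = a * b * a' * b') := by
  refine ⟨fun x y => ?_, by simp, (Bialgebra.mulCoalgHom k A).map_comp_comul.symm,
    (Bialgebra.mulCoalgHom k A).counit_comp, fun a b a' b' => ?_⟩
  · induction x with
    | zero => simp
    | add x x' hx hx' => simp only [add_tmul, map_add, add_mul, hx, hx']
    | tmul a u =>
      induction y with
      | zero => simp
      | add y y' hy hy' => simp only [tmul_add, map_add, mul_add, hy, hy']
      | tmul b v =>
        rw [hmulD, mul'_tmul_one_mul_mul_one_tmul, mul'_doubleInner hβ hinv₁]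
        simp [mul_assoc]
  · rw [mul'_doubleInner hβ hinv₁, mul_assoc a b a']

end
end
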